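/- arXiv:1310.1603 — 2 statements merged into one kernel-verified Lean document; each statement's English description precedes it below -/
import Mathlib

section
/- Let N be an integral g-lattice and M a g-maximal g-lattice in a nondegenerate ternary quadratic space (W,ψ) over an algebraic number field F (or over a nonarchimedean local field). Then the fractional ideal [A⁺(M)/A⁺(N)] does not depend on the choice of the g-maximal lattice M, and [A⁺(M)/A⁺(N)] = [M/N]². -/
noncomputable section

namespace Paper

variable (R F : Type*) [CommRing R] [Field F] [Algebra R F]

section Lattices

variable (W : Type*) [AddCommGroup W] [Module F W] [Module R W] [IsScalarTower R F W]

/-- A `g`-lattice in `W`: a finitely generated `R`-submodule containing an `F`-basis. -/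
def IsLat (L : Submodule R W) : Prop :=
  L.FG ∧ Submodule.span F (L : Set W) = ⊤

/-- integral lattice with respect to a bilinear form -/
def IsIntegralLat (ψ : LinearMap.BilinForm F W) (L : Submodule R W) : Prop :=
  IsLat R F W L ∧ ∀ x ∈ L, ψ x x ∈ (algebraMap R F).range

/-- maximal lattice with respect to a bilinear form -/
def IsMaximalLat (ψ : LinearMap.BilinForm F W) (L : Submodule R W) : Prop :=
  IsIntegralLat R F W ψ L ∧ ∀ L' : Submodule R W, IsIntegralLat R F W ψ L' → L ≤ L' → L' = L

/-- the ideal `[L/M]` generated by determinants of `F`-automorphisms carrying `L` into `M` -/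
def latIdx (L M : Submodule R W) : Submodule R F :=
  Submodule.span R {d : F | ∃ α : W ≃ₗ[F] W, (∀ x ∈ L, α x ∈ M) ∧
    LinearMap.det (α : W →ₗ[F] W) = d}

/-- the dual lattice `L~ = {x | 2ψ(x,L) ⊆ g}` -/
def dualLat (ψ : LinearMap.BilinForm F W) (L : Submodule R W) : Submodule R W :=
  ⨅ y ∈ L, Submodule.comap (((2 : F) • (ψ.flip y)).restrictScalars R)
    (LinearMap.range (Algebra.linearMap R F))

/-- the ideal `[L/M]` for lattices spanning the subspace `U`, computed inside `U` -/
def latIdxIn (U : Submodule F W) (L M : Submodule R W) : Submodule R F :=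
  latIdx R F ↥U (Submodule.comap ((U.subtype).restrictScalars R) L)
    (Submodule.comap ((U.subtype).restrictScalars R) M)

/-- product of a fractional ideal and a lattice -/
def idSMul {M : Type*} [AddCommGroup M] [Module F M] [Module R M] [IsScalarTower R F M]
    (I : Submodule R F) (N : Submodule R M) : Submodule R M :=
  Submodule.span R {z : M | ∃ c ∈ I, ∃ x ∈ N, z = c • x}

end Lattices

/-- the fractional ideal attached to an integral ideal -/
def idealToF (I : Ideal R) : Submodule R F :=
  Submodule.map (Algebra.linearMap R F) I

section Clifford

variable (W : Type*) [AddCommGroup W] [Module F W] [Module R W] [IsScalarTower R F W]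
variable (Q : QuadraticForm F W)

/-- the order `A(N)` generated by `g` and `N` in the Clifford algebra -/
def cliffordOrder (N : Submodule R W) : Subalgebra R (CliffordAlgebra Q) :=
  Algebra.adjoin R (CliffordAlgebra.ι Q '' (N : Set W))

/-- the even Clifford algebra, as an `R`-subalgebra -/
def evenR : Subalgebra R (CliffordAlgebra Q) :=
  (CliffordAlgebra.even Q).restrictScalars R

/-- `A⁺(N) = A⁺(W) ∩ A(N)` -/
def APlus (N : Submodule R W) : Subalgebra R (CliffordAlgebra Q) :=
  evenR R F W Q ⊓ cliffordOrder R F W Q N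

def APlusSub (N : Submodule R W) : Submodule R (CliffordAlgebra Q) :=
  Subalgebra.toSubmodule (APlus R F W Q N)

def oneLat : Submodule R (CliffordAlgebra Q) :=
  LinearMap.range (Algebra.linearMap R (CliffordAlgebra Q))

/-- the `R`-linear map `x ↦ 2ν(x,y) = x·y* + y·x*`, where `*` is the canonical
involution (reversal) of the Clifford algebra -/
def traceMap (y : CliffordAlgebra Q) : CliffordAlgebra Q →ₗ[R] CliffordAlgebra Q :=
  ((LinearMap.mulRight F (CliffordAlgebra.reverse (Q := Q) y)) +
    (LinearMap.mulLeft F y) ∘ₗ (CliffordAlgebra.reverse (Q := Q))).restrictScalars R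

/-- the dual `o~ = {x ∈ A⁺(W) | 2ν(x,o) ⊆ g}` with respect to the norm form
`ν[x] = x x*` of the even Clifford algebra -/
def normDual (o : Submodule R (CliffordAlgebra Q)) : Submodule R (CliffordAlgebra Q) :=
  Subalgebra.toSubmodule (evenR R F W Q) ⊓
    ⨅ y ∈ o, Submodule.comap (traceMap R F W Q y) (oneLat R F W Q)

/-- `A⁺(W)° = {x ∈ A⁺(W) | x* = -x}`, as an `R`-submodule -/
def minusPart : Submodule R (CliffordAlgebra Q) :=
  Subalgebra.toSubmodule (evenR R F W Q) ⊓
    LinearMap.ker ((CliffordAlgebra.reverse (Q := Q) + LinearMap.id).restrictScalars R)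

end Clifford

end Paper

namespace Paper

section Orders

variable (R F : Type*) [CommRing R] [Field F] [Algebra R F]
variable (A : Type*) [Ring A] [Algebra F A] [Algebra R A] [IsScalarTower R F A]

/-- an order in the `F`-subalgebra `B` of `A`: an `R`-subalgebra which is an `R`-lattice
in `B` -/
def IsOrderIn (B : Subalgebra F A) (o : Subalgebra R A) : Prop :=
  (Subalgebra.toSubmodule o).FG ∧ (o : Set A) ⊆ (B : Set A) ∧
    Submodule.span F (o : Set A) = Subalgebra.toSubmodule B

/-- a maximal order in `B` -/
def IsMaximalOrderIn (B : Subalgebra F A) (o : Subalgebra R A) : Prop :=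
  IsOrderIn R F A B o ∧ ∀ o' : Subalgebra R A, IsOrderIn R F A B o' → o ≤ o' → o' = o

end Orders

section Abbrev

variable (R F : Type*) [CommRing R] [Field F] [Algebra R F]
variable (W : Type*) [AddCommGroup W] [Module F W] [Module R W] [IsScalarTower R F W]
variable (psi : LinearMap.BilinForm F W)

/-- the ideal `[A⁺(M)/A⁺(N)]`, computed inside the quaternion algebra `A⁺(W)` -/
def APlusIdx (M N : Submodule R W) : Submodule R F :=
  latIdxIn R F (CliffordAlgebra (LinearMap.BilinMap.toQuadraticMap psi))
    (Subalgebra.toSubmodule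
      (CliffordAlgebra.even (LinearMap.BilinMap.toQuadraticMap psi)))
    (APlusSub R F W (LinearMap.BilinMap.toQuadraticMap psi) M)
    (APlusSub R F W (LinearMap.BilinMap.toQuadraticMap psi) N)

/-- the ideal `[A⁺(N)~/A⁺(N)]`, computed inside the quaternion algebra `A⁺(W)` -/
def APlusDualIdx (N : Submodule R W) : Submodule R F :=
  latIdxIn R F (CliffordAlgebra (LinearMap.BilinMap.toQuadraticMap psi))
    (Subalgebra.toSubmodule
      (CliffordAlgebra.even (LinearMap.BilinMap.toQuadraticMap psi)))
    (normDual R F W (LinearMap.BilinMap.toQuadraticMap psi)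
      (APlusSub R F W (LinearMap.BilinMap.toQuadraticMap psi) N))
    (APlusSub R F W (LinearMap.BilinMap.toQuadraticMap psi) N)

/-- the fractional ideal `2⁻¹·[Ñ/N]` -/
def halfDualIdx (N : Submodule R W) : Submodule R F :=
  Submodule.span R {((2 : F)⁻¹)} * latIdx R F W (dualLat R F W psi N) N

end Abbrev

end Paper

namespace Paper

open Module Submodule

section Index

variable {R F W : Type*} [CommRing R] [Field F] [Algebra R F]
variable [AddCommGroup W] [Module F W] [Module R W] [IsScalarTower R F W]
variable {ι : Type*} [Fintype ι] [DecidableEq ι]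

/-- Lattices spanned by bases have index generated by the determinant of the base change. -/
theorem latIdx_span_range (v w : Basis ι F W) :
    latIdx R F W (span R (Set.range v)) (span R (Set.range w)) = span R {v.det w} := by
  apply le_antisymm
  · refine span_le.2 ?_
    rintro d ⟨α, hα, rfl⟩
    have h1 : ∀ j, ∃ c : ι → R, ∑ i, c i • w i = α (v j) := fun j =>
      (Submodule.mem_span_range_iff_exists_fun R).1 (hα _ (subset_span ⟨j, rfl⟩))
    choose c hc using h1
    have h2 : LinearMap.det (α : W →ₗ[F] W) = v.det (fun j => α (v j)) := by
      have := v.det_comp (α : W →ₗ[F] W) v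
      rw [v.det_self, mul_one] at this
      exact this.symm
    have h3 : w.toMatrix (fun j => α (v j)) =
        (algebraMap R F).mapMatrix (Matrix.of fun i j => c j i) := by
      ext i j
      rw [Basis.toMatrix_apply, ← hc j]
      have : ∑ k, c j k • w k = ∑ k, (algebraMap R F (c j k)) • w k := by
        simp only [algebraMap_smul]
      rw [this, w.repr_sum_self]
      simp
    have h4 : v.det (fun j => α (v j)) = v.det w * w.det (fun j => α (v j)) := by
      rw [Basis.det_apply, Basis.det_apply, Basis.det_apply, ← Matrix.det_mul,
        Basis.toMatrix_mul_toMatrix]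
    have h5 : w.det (fun j => α (v j)) = algebraMap R F (Matrix.of fun i j => c j i).det := by
      rw [Basis.det_apply, h3, RingHom.map_det]
    rw [h2, h4, h5, mul_comm, ← Algebra.smul_def]
    exact smul_mem _ _ (subset_span rfl)
  · refine span_le.2 ?_
    rintro _ rfl
    refine subset_span ⟨v.equiv w (Equiv.refl ι), ?_, ?_⟩
    · intro x hx
      induction hx using span_induction with
      | mem x hx =>
        obtain ⟨i, rfl⟩ := hx
        exact subset_span ⟨i, by simp⟩
      | zero => simp
      | add x y _ _ hx hy => rw [map_add]; exact add_mem hx hy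
      | smul a x _ hx =>
        rw [← algebraMap_smul F, map_smul, algebraMap_smul]; exact smul_mem _ _ hx
    · have := v.det_comp (v.equiv w (Equiv.refl ι) : W →ₗ[F] W) v
      rw [v.det_self, mul_one] at this
      rw [← this]
      congr 1
      ext i
      simp

omit [DecidableEq ι] in
theorem isLat_span_range (v : Basis ι F W) : IsLat R F W (span R (Set.range v)) :=
  ⟨fg_span (Set.finite_range v), by rw [span_span_of_tower, v.span_eq]⟩

theorem dualSubmodule_sup (B : LinearMap.BilinForm F W) (L M : Submodule R W) :
    B.dualSubmodule (L ⊔ M) = B.dualSubmodule L ⊓ B.dualSubmodule M := by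
  ext x
  simp only [LinearMap.BilinForm.mem_dualSubmodule, mem_inf]
  refine ⟨fun h => ⟨fun y hy => h y (mem_sup_left hy), fun y hy => h y (mem_sup_right hy)⟩, ?_⟩
  rintro ⟨h1, h2⟩ y hy
  obtain ⟨a, ha, b, hb, rfl⟩ := mem_sup.1 hy
  rw [map_add]
  exact add_mem (h1 a ha) (h2 b hb)

variable [IsDomain R] [IsPrincipalIdealRing R] [IsFractionRing R F]

theorem IsLat.exists_basis {L : Submodule R W} (hL : IsLat R F W L) {n : ℕ}
    (hn : finrank F W = n) : ∃ v : Basis (Fin n) F W, span R (Set.range v) = L := by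
  have : IsLattice F L := ⟨hL.1, hL.2⟩
  have : IsTorsionFree R F := inferInstance
  have : Module.Free R L := IsLattice.free (K := F) L
  have : Module.Finite R L := IsLattice.finite F L
  let b := Module.finBasis R L
  have hr : finrank R L = n := by
    rw [← hn, Module.finrank, Module.finrank, IsLattice.rank' F L]
  refine ⟨(b.extendOfIsLattice F).reindex (finCongr hr), ?_⟩
  rw [Basis.range_reindex]
  have : (Set.range (b.extendOfIsLattice F)) = L.subtype '' Set.range b := by
    rw [← Set.range_comp]; congr 1; ext i; simp
  rw [this, ← Submodule.map_span, b.span_eq, Submodule.map_top, range_subtype]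

theorem latIdx_mul {L M K : Submodule R W} (hL : IsLat R F W L) (hM : IsLat R F W M)
    (hK : IsLat R F W K) :
    latIdx R F W L M * latIdx R F W M K = latIdx R F W L K := by
  obtain ⟨u, rfl⟩ := hL.exists_basis rfl
  obtain ⟨v, rfl⟩ := hM.exists_basis rfl
  obtain ⟨w, rfl⟩ := hK.exists_basis rfl
  rw [latIdx_span_range, latIdx_span_range, latIdx_span_range, span_mul_span,
    Set.singleton_mul_singleton]
  rw [Basis.det_apply, Basis.det_apply, Basis.det_apply, ← Matrix.det_mul,
        Basis.toMatrix_mul_toMatrix]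

theorem latIdx_dualSubmodule (B : LinearMap.BilinForm F W) (hB : B.Nondegenerate)
    (hs : B.IsSymm) {L M : Submodule R W} (hL : IsLat R F W L) (hM : IsLat R F W M) :
    latIdx R F W L M = latIdx R F W (B.dualSubmodule M) (B.dualSubmodule L) := by
  obtain ⟨v, rfl⟩ := hL.exists_basis rfl
  obtain ⟨w, rfl⟩ := hM.exists_basis rfl
  rw [B.dualSubmodule_span_of_basis hB, B.dualSubmodule_span_of_basis hB, latIdx_span_range,
    latIdx_span_range, Basis.det_apply, Basis.det_apply, ← Matrix.det_transpose]
  congr 3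
  ext i j
  rw [Matrix.transpose_apply, Basis.toMatrix_apply, Basis.toMatrix_apply,
    LinearMap.BilinForm.dualBasis_repr_apply]
  conv_lhs => rw [← LinearMap.BilinForm.dualBasis_dualBasis hB hs v]
  rw [LinearMap.BilinForm.dualBasis_repr_apply]
  exact hs.eq _ _

theorem IsLat.dualSubmodule (B : LinearMap.BilinForm F W) (hB : B.Nondegenerate)
    {L : Submodule R W} (hL : IsLat R F W L) : IsLat R F W (B.dualSubmodule L) := by
  obtain ⟨v, rfl⟩ := hL.exists_basis rfl
  rw [B.dualSubmodule_span_of_basis hB]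
  exact isLat_span_range _

theorem dualSubmodule_dualSubmodule (B : LinearMap.BilinForm F W) (hB : B.Nondegenerate)
    (hs : B.IsSymm) {L : Submodule R W} (hL : IsLat R F W L) :
    B.dualSubmodule (B.dualSubmodule L) = L := by
  obtain ⟨v, rfl⟩ := hL.exists_basis rfl
  exact B.dualSubmodule_dualSubmodule_of_basis hB hs v

theorem IsLat.exists_smul_mem {L M : Submodule R W} (hL : IsLat R F W L)
    (hM : IsLat R F W M) : ∃ t : R, t ≠ 0 ∧ ∀ x ∈ M, t • x ∈ L := by
  obtain ⟨v, rfl⟩ := hL.exists_basis rfl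
  obtain ⟨w, rfl⟩ := hM.exists_basis rfl
  obtain ⟨t, ht⟩ := IsLocalization.exist_integer_multiples_of_finite (nonZeroDivisors R)
    (fun p : Fin (finrank F W) × Fin (finrank F W) => v.repr (w p.1) p.2)
  refine ⟨t, nonZeroDivisors.ne_zero t.2, ?_⟩
  intro x hx
  induction hx using span_induction with
  | mem x hx =>
    obtain ⟨j, rfl⟩ := hx
    rw [← v.sum_repr (w j), Finset.smul_sum]
    refine sum_mem fun i _ => ?_
    obtain ⟨r, hr⟩ := ht (j, i)
    rw [← smul_assoc]
    erw [← hr]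
    rw [algebraMap_smul]
    exact smul_mem _ _ (subset_span ⟨i, rfl⟩)
  | zero => simp
  | add x y _ _ hx hy => rw [smul_add]; exact add_mem hx hy
  | smul a x _ hx => rw [smul_comm]; exact smul_mem _ _ hx

theorem IsLat.exists_basis_unitsSMul_of_le {L M : Submodule R W} (hL : IsLat R F W L)
    (hM : IsLat R F W M) (hle : M ≤ L) {n : ℕ} (hn : finrank F W = n) :
    ∃ (v : Basis (Fin n) F W) (c : Fin n → Fˣ), span R (Set.range v) = L ∧
      span R (Set.range (v.unitsSMul c)) = M := by
  have : IsLattice F L := ⟨hL.1, hL.2⟩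
  have : IsLattice F M := ⟨hM.1, hM.2⟩
  have : Module.Free R L := IsLattice.free (K := F) L
  have : Module.Finite R L := IsLattice.finite F L
  have hr : finrank R L = n := by
    rw [← hn, Module.finrank, Module.finrank, IsLattice.rank' F L]
  let e := comapSubtypeEquivOfLe hle
  have hr' : finrank R (M.comap L.subtype) = finrank R L := by
    rw [e.finrank_eq, hr, ← hn, Module.finrank, Module.finrank, IsLattice.rank' F M]
  obtain ⟨b, a, b', hb⟩ := exists_smith_normal_form_of_rank_eq
    ((Module.finBasis R L).reindex (finCongr hr)) hr'
  have hspan : ∀ {K : Submodule R W} (b : Basis (Fin n) R K),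
      span R (Set.range fun i => (b i : W)) = K := fun {K} b => by
    have : (Set.range fun i => (b i : W)) = K.subtype '' Set.range b := by
      rw [← Set.range_comp]; rfl
    rw [this, ← Submodule.map_span, b.span_eq, Submodule.map_top, range_subtype]
  have ha : ∀ i, algebraMap R F (a i) ≠ 0 := fun i h => by
    have h0 : a i = 0 := (IsFractionRing.injective R F) (by rw [h, map_zero])
    refine b'.ne_zero i (Subtype.ext ?_)
    rw [hb, h0, zero_smul]; rfl
  refine ⟨b.extendOfIsLattice F, fun i => Units.mk0 _ (ha i), ?_, ?_⟩
  · conv_rhs => rw [← hspan b]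
    congr 2; ext i; simp
  · conv_rhs => rw [← hspan (b'.map e)]
    congr 2; ext i
    have : ((e (b' i) : M) : W) = ((b' i : L) : W) := rfl
    simp [Basis.unitsSMul_apply, Units.smul_def, this, hb]

/-- Two lattices over a principal ideal domain have proportional bases. -/
theorem IsLat.exists_basis_unitsSMul {L M : Submodule R W} (hL : IsLat R F W L)
    (hM : IsLat R F W M) {n : ℕ} (hn : finrank F W = n) :
    ∃ (v : Basis (Fin n) F W) (c : Fin n → Fˣ), span R (Set.range v) = L ∧
      span R (Set.range (v.unitsSMul c)) = M := by
  obtain ⟨t, ht0, ht⟩ := hL.exists_smul_mem hM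
  have ht0' : algebraMap R F t ≠ 0 := fun h =>
    ht0 ((IsFractionRing.injective R F) (by rw [h, map_zero]))
  let u : Fˣ := Units.mk0 _ ht0'
  have key : ∀ (w : Basis (Fin n) F W) (s : Fˣ),
      span R (Set.range (w.unitsSMul fun _ => s)) =
        (span R (Set.range w)).map ((LinearMap.lsmul F W (s : F)).restrictScalars R) := by
    intro w s
    rw [map_span, ← Set.range_comp]
    congr 2
    ext i
    simp [Basis.unitsSMul_apply, Units.smul_def]
  obtain ⟨w, rfl⟩ := hM.exists_basis hn
  obtain ⟨v, c, hv, hc⟩ := hL.exists_basis_unitsSMul_of_le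
    (isLat_span_range (w.unitsSMul fun _ => u)) (by
      rw [key]
      rintro _ ⟨x, hx, rfl⟩
      have := ht x hx
      rw [← algebraMap_smul F] at this
      exact this) hn
  refine ⟨v, fun i => u⁻¹ * c i, hv, ?_⟩
  have h1 : v.unitsSMul (fun i => u⁻¹ * c i) = (v.unitsSMul c).unitsSMul fun _ => u⁻¹ := by
    ext i; simp [Basis.unitsSMul_apply, mul_smul]
  rw [h1, key, hc, key, ← map_comp]
  convert! map_id _
  ext x
  simp

theorem IsLat.sup_inf [ValuationRing R] {L M : Submodule R W} (hL : IsLat R F W L)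
    (hM : IsLat R F W M) :
    IsLat R F W (L ⊔ M) ∧ IsLat R F W (L ⊓ M) ∧
      latIdx R F W L (L ⊓ M) = latIdx R F W (L ⊔ M) M := by
  classical
  obtain ⟨v, c, rfl, rfl⟩ := hL.exists_basis_unitsSMul hM rfl
  let P : Fin (finrank F W) → Prop := fun i => ∃ r : R, algebraMap R F r = c i
  have hP : ∀ i, ¬ P i → ∃ r : R, algebraMap R F r = (c i)⁻¹ := fun i hi => by
    rcases (ValuationRing.iff_isInteger_or_isInteger R (K := F)).1 inferInstance (c i : F)
      with h | h
    · exact absurd h hi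
    · obtain ⟨r, hr⟩ := h
      exact ⟨r, by simpa using hr⟩
  let s : Fin (finrank F W) → Fˣ := fun i => if P i then c i else 1
  let t : Fin (finrank F W) → Fˣ := fun i => if P i then 1 else c i
  have hst : ∀ i, s i * t i = c i := fun i => by
    by_cases h : P i <;> simp [s, t, h]
  have hmem : ∀ (b : Basis (Fin (finrank F W)) F W) x,
      x ∈ span R (Set.range b) ↔ ∀ i, ∃ r : R, algebraMap R F r = b.repr x i := fun b x =>
    b.mem_span_iff_repr_mem R x
  have hrepr : ∀ (d : Fin (finrank F W) → Fˣ) x i,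
      (v.unitsSMul d).repr x i = (d i)⁻¹ * v.repr x i := fun d x i => by
    rw [Basis.repr_unitsSMul]; simp [Units.smul_def]
  have hc : (v.unitsSMul t).unitsSMul s = v.unitsSMul c := by
    ext i; simp [Basis.unitsSMul_apply, ← mul_smul, hst]
  have hsup : span R (Set.range v) ⊔ span R (Set.range (v.unitsSMul c)) =
      span R (Set.range (v.unitsSMul t)) := by
    rw [← span_union]
    apply le_antisymm <;> rw [span_le]
    · rintro _ (⟨i, rfl⟩ | ⟨i, rfl⟩)
      · by_cases h : P i
        · exact subset_span ⟨i, by simp [Basis.unitsSMul_apply, t, h]⟩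
        · obtain ⟨r, hr⟩ := hP i h
          have : v i = r • v.unitsSMul t i := by
            rw [← algebraMap_smul F, hr]
            simp [Basis.unitsSMul_apply, t, h, Units.smul_def]
          rw [this]
          exact smul_mem _ _ (subset_span ⟨i, rfl⟩)
      · by_cases h : P i
        · obtain ⟨r, hr⟩ := id h
          have : v.unitsSMul c i = r • v.unitsSMul t i := by
            rw [← algebraMap_smul F, hr]
            simp [Basis.unitsSMul_apply, t, h, Units.smul_def]
          rw [this]
          exact smul_mem _ _ (subset_span ⟨i, rfl⟩)
        · exact subset_span ⟨i, by simp [Basis.unitsSMul_apply, t, h]⟩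
    · rintro _ ⟨i, rfl⟩
      by_cases h : P i
      · exact subset_span (Or.inl ⟨i, by simp [Basis.unitsSMul_apply, t, h]⟩)
      · exact subset_span (Or.inr ⟨i, by simp [Basis.unitsSMul_apply, t, h]⟩)
  have hinf : span R (Set.range v) ⊓ span R (Set.range (v.unitsSMul c)) =
      span R (Set.range (v.unitsSMul s)) := by
    ext x
    rw [mem_inf, hmem, hmem, hmem]
    simp only [hrepr]
    rw [← forall_and]
    refine forall_congr' fun i => ?_
    by_cases h : P i
    · simp only [s, h, if_true]
      refine ⟨fun h => h.2, fun hx => ⟨?_, hx⟩⟩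
      obtain ⟨r, hr⟩ := h
      obtain ⟨q, hq⟩ := hx
      refine ⟨r * q, ?_⟩
      rw [map_mul, hr, hq]
      simp
    · simp only [s, h, if_false]
      obtain ⟨r, hr⟩ := hP i h
      refine ⟨fun h => by simpa using h.1, fun hx => ⟨by simpa using hx, ?_⟩⟩
      obtain ⟨q, hq⟩ := hx
      refine ⟨r * q, ?_⟩
      rw [map_mul, hr, hq]
      simp
  rw [hsup, hinf]
  refine ⟨isLat_span_range _, isLat_span_range _, ?_⟩
  rw [latIdx_span_range, ← hc, latIdx_span_range, Basis.det_unitsSMul_self,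
    Basis.det_unitsSMul_self]

end Index

section Maximal

variable {R F W : Type*} [CommRing R] [Field F] [Algebra R F]
variable [AddCommGroup W] [Module F W] [Module R W] [IsScalarTower R F W]

omit [IsScalarTower R F W] in
theorem IsIntegralLat.two_mul_mem {ψ : LinearMap.BilinForm F W} (hs : ψ.IsSymm)
    {L : Submodule R W} (hL : IsIntegralLat R F W ψ L) {x y : W} (hx : x ∈ L) (hy : y ∈ L) :
    2 * ψ x y ∈ (algebraMap R F).range := by
  have h : 2 * ψ x y = ψ (x + y) (x + y) - ψ x x - ψ y y := by
    have : ψ y x = ψ x y := hs.eq y x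
    simp only [map_add, LinearMap.add_apply, this]
    ring
  rw [h]
  exact sub_mem (sub_mem (hL.2 _ (add_mem hx hy)) (hL.2 _ hx)) (hL.2 _ hy)

/-- A vector with integral value that pairs integrally with a maximal lattice belongs to it. -/
theorem IsMaximalLat.mem_of_forall {ψ : LinearMap.BilinForm F W} (hs : ψ.IsSymm)
    {M : Submodule R W} (hM : IsMaximalLat R F W ψ M) {x : W}
    (hx : ψ x x ∈ (algebraMap R F).range)
    (hxM : ∀ y ∈ M, 2 * ψ x y ∈ (algebraMap R F).range) : x ∈ M := by
  have h : IsIntegralLat R F W ψ (M ⊔ span R {x}) := by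
    refine ⟨⟨hM.1.1.1.sup (fg_span_singleton x), ?_⟩, ?_⟩
    · rw [eq_top_iff, ← hM.1.1.2]
      exact span_mono (le_sup_left (a := M) (b := span R {x}))
    · intro z hz
      obtain ⟨y, hy, w, hw, rfl⟩ := mem_sup.1 hz
      obtain ⟨r, rfl⟩ := mem_span_singleton.1 hw
      have h1 : ψ (y + r • x) (y + r • x) =
          ψ y y + algebraMap R F r * (2 * ψ x y) +
            algebraMap R F r * algebraMap R F r * ψ x x := by
        have : ψ y x = ψ x y := hs.eq y x
        rw [← algebraMap_smul F r x]
        simp only [map_add, LinearMap.add_apply, map_smul, LinearMap.smul_apply, smul_eq_mul,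
          this]
        ring
      rw [h1]
      exact add_mem (add_mem (hM.1.2 y hy) (mul_mem ⟨r, rfl⟩ (hxM y hy)))
        (mul_mem (mul_mem ⟨r, rfl⟩ ⟨r, rfl⟩) hx)
  rw [← hM.2 _ h le_sup_left]
  exact mem_sup_right (mem_span_singleton_self x)

theorem mem_dualSubmodule_two_smul {ψ : LinearMap.BilinForm F W} {L : Submodule R W} {x : W} :
    x ∈ LinearMap.BilinForm.dualSubmodule ((2 : F) • ψ) L ↔
      ∀ y ∈ L, 2 * ψ x y ∈ (algebraMap R F).range := by
  simp [LinearMap.BilinForm.mem_dualSubmodule]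

theorem IsMaximalLat.inf_dualSubmodule {ψ : LinearMap.BilinForm F W} (hs : ψ.IsSymm)
    {M M' : Submodule R W} (hM : IsIntegralLat R F W ψ M) (hM' : IsMaximalLat R F W ψ M') :
    M ⊓ LinearMap.BilinForm.dualSubmodule ((2 : F) • ψ) M' = M ⊓ M' := by
  ext x
  simp only [mem_inf, mem_dualSubmodule_two_smul]
  exact and_congr_right fun hx => ⟨fun h => hM'.mem_of_forall hs (hM.2 x hx) h,
    fun h y hy => hM'.1.two_mul_mem hs h hy⟩

/-- Over a valuation ring that is a principal ideal domain, every lattice has the same index in all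
maximal lattices of a quadratic space. -/
theorem IsMaximalLat.latIdx_eq [IsDomain R] [IsPrincipalIdealRing R] [ValuationRing R]
    [IsFractionRing R F] [FiniteDimensional F W] (h2 : (2 : F) ≠ 0)
    {ψ : LinearMap.BilinForm F W} (hs : ψ.IsSymm) (hψ : ψ.Nondegenerate)
    {M M' N : Submodule R W} (hM : IsMaximalLat R F W ψ M) (hM' : IsMaximalLat R F W ψ M')
    (hN : IsLat R F W N) : latIdx R F W M N = latIdx R F W M' N := by
  classical
  let B : LinearMap.BilinForm F W := (2 : F) • ψ
  have hBs : B.IsSymm := ⟨fun x y => by simp [B, hs.eq x y]⟩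
  have hB : B.Nondegenerate := by
    constructor
    · intro x hx
      refine hψ.1 x fun y => ?_
      simpa [B, h2] using hx y
    · intro x hx
      refine hψ.2 x fun y => ?_
      simpa [B, h2] using hx y
  have hL := hM.1.1
  have hL' := hM'.1.1
  have hD' := hL'.dualSubmodule B hB
  have h1 : M ⊓ B.dualSubmodule M' = M ⊓ M' := IsMaximalLat.inf_dualSubmodule hs hM.1 hM'
  have h2 : M' ⊓ B.dualSubmodule M = M ⊓ M' := by
    rw [inf_comm M M']; exact IsMaximalLat.inf_dualSubmodule hs hM'.1 hM
  obtain ⟨hK1, hK, hK2⟩ := hL.sup_inf hD'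
  rw [h1] at hK hK2
  have h3 : latIdx R F W M (M ⊓ M') = latIdx R F W M' (M ⊓ M') := by
    rw [hK2, latIdx_dualSubmodule B hB hBs hK1 hD', dualSubmodule_sup,
      dualSubmodule_dualSubmodule B hB hBs hL', inf_comm, h2]
  rw [← latIdx_mul hL hK hN, ← latIdx_mul hL' hK hN, h3]

end Maximal

section Monomials

variable {R A : Type*} [CommRing R] [Ring A] [Algebra R A]

/-- The even monomials in three elements. -/
def evenMonomials (e : Fin 3 → A) : Fin 4 → A := ![1, e 0 * e 1, e 0 * e 2, e 1 * e 2]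

/-- The odd monomials in three elements. -/
def oddMonomials (e : Fin 3 → A) : Fin 4 → A := ![e 0, e 1, e 2, e 0 * (e 1 * e 2)]

theorem adjoin_le_span_monomials (e : Fin 3 → A) (b : Fin 3 → Fin 3 → R)
    (hq : ∀ i, ∃ q : R, e i * e i = q • 1)
    (hb : ∀ i j, e j * e i = b i j • 1 - e i * e j) :
    Subalgebra.toSubmodule (Algebra.adjoin R (Set.range e)) ≤
      span R (Set.range (evenMonomials e)) ⊔ span R (Set.range (oddMonomials e)) := by
  choose q hq using hq
  set K := span R (Set.range (evenMonomials e)) ⊔ span R (Set.range (oddMonomials e)) with hK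
  have m0 : (1 : A) ∈ K := mem_sup_left (subset_span ⟨0, rfl⟩)
  have m01 : e 0 * e 1 ∈ K := mem_sup_left (subset_span ⟨1, rfl⟩)
  have m02 : e 0 * e 2 ∈ K := mem_sup_left (subset_span ⟨2, rfl⟩)
  have m12 : e 1 * e 2 ∈ K := mem_sup_left (subset_span ⟨3, rfl⟩)
  have n0 : e 0 ∈ K := mem_sup_right (subset_span ⟨0, rfl⟩)
  have n1 : e 1 ∈ K := mem_sup_right (subset_span ⟨1, rfl⟩)
  have n2 : e 2 ∈ K := mem_sup_right (subset_span ⟨2, rfl⟩)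
  have n3 : e 0 * (e 1 * e 2) ∈ K := mem_sup_right (subset_span ⟨3, rfl⟩)
  have hsq : ∀ i x, e i * (e i * x) = q i • x := fun i x => by
    rw [← mul_assoc, hq, smul_mul_assoc, one_mul]
  have hsw : ∀ i j x, e j * (e i * x) = b i j • x - e i * (e j * x) := fun i j x => by
    rw [← mul_assoc, hb i j, sub_mul, smul_mul_assoc, one_mul, mul_assoc]
  have step : ∀ i, ∀ k ∈ K, e i * k ∈ K := by
    intro i k hk
    rw [hK, ← span_union] at hk
    induction hk using span_induction with
    | zero => simp
    | add x y _ _ hx hy => rw [mul_add]; exact add_mem hx hy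
    | smul a x _ hx => rw [mul_smul_comm]; exact K.smul_mem _ hx
    | mem x hx =>
      rcases hx with ⟨j, rfl⟩ | ⟨j, rfl⟩
      · fin_cases j
        · fin_cases i <;> simpa [evenMonomials]
        · fin_cases i
          · change e 0 * (e 0 * e 1) ∈ K
            rw [hsq]; exact K.smul_mem _ n1
          · change e 1 * (e 0 * e 1) ∈ K
            rw [hsw 0 1, hq, mul_smul_comm, mul_one]
            exact sub_mem (K.smul_mem _ n1) (K.smul_mem _ n0)
          · change e 2 * (e 0 * e 1) ∈ K
            rw [hsw 0 2, hb 1 2, mul_sub, mul_smul_comm, mul_one]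
            exact sub_mem (K.smul_mem _ n1) (sub_mem (K.smul_mem _ n0) n3)
        · fin_cases i
          · change e 0 * (e 0 * e 2) ∈ K
            rw [hsq]; exact K.smul_mem _ n2
          · change e 1 * (e 0 * e 2) ∈ K
            rw [hsw 0 1]
            exact sub_mem (K.smul_mem _ n2) n3
          · change e 2 * (e 0 * e 2) ∈ K
            rw [hsw 0 2, hq, mul_smul_comm, mul_one]
            exact sub_mem (K.smul_mem _ n2) (K.smul_mem _ n0)
        · fin_cases i
          · exact n3
          · change e 1 * (e 1 * e 2) ∈ K
            rw [hsq]; exact K.smul_mem _ n2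
          · change e 2 * (e 1 * e 2) ∈ K
            rw [hsw 1 2, hq, mul_smul_comm, mul_one]
            exact sub_mem (K.smul_mem _ n2) (K.smul_mem _ n1)
      · fin_cases j
        · fin_cases i
          · change e 0 * e 0 ∈ K
            rw [hq]; exact K.smul_mem _ m0
          · change e 1 * e 0 ∈ K
            rw [hb 0 1]; exact sub_mem (K.smul_mem _ m0) m01
          · change e 2 * e 0 ∈ K
            rw [hb 0 2]; exact sub_mem (K.smul_mem _ m0) m02
        · fin_cases i
          · exact m01
          · change e 1 * e 1 ∈ K
            rw [hq]; exact K.smul_mem _ m0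
          · change e 2 * e 1 ∈ K
            rw [hb 1 2]; exact sub_mem (K.smul_mem _ m0) m12
        · fin_cases i
          · exact m02
          · exact m12
          · change e 2 * e 2 ∈ K
            rw [hq]; exact K.smul_mem _ m0
        · fin_cases i
          · change e 0 * (e 0 * (e 1 * e 2)) ∈ K
            rw [hsq]; exact K.smul_mem _ m12
          · change e 1 * (e 0 * (e 1 * e 2)) ∈ K
            rw [hsw 0 1, hsq, mul_smul_comm]
            exact sub_mem (K.smul_mem _ m12) (K.smul_mem _ m02)
          · change e 2 * (e 0 * (e 1 * e 2)) ∈ K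
            rw [hsw 0 2, hsw 1 2, hq, mul_sub, mul_smul_comm, mul_smul_comm, mul_smul_comm,
              mul_one]
            exact sub_mem (K.smul_mem _ m12) (sub_mem (K.smul_mem _ m02) (K.smul_mem _ m01))
  intro x hx
  suffices h : ∀ k ∈ K, x * k ∈ K by simpa using h 1 m0
  rw [Subalgebra.mem_toSubmodule] at hx
  induction hx using Algebra.adjoin_induction with
  | mem x hx => obtain ⟨i, rfl⟩ := hx; exact step i
  | algebraMap r => intro k hk; rw [← Algebra.smul_def]; exact K.smul_mem _ hk
  | add x y _ _ hx hy => intro k hk; rw [add_mul]; exact add_mem (hx k hk) (hy k hk)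
  | mul x y _ _ hx hy => intro k hk; rw [mul_assoc]; exact hx _ (hy k hk)

theorem span_evenMonomials_le_adjoin (e : Fin 3 → A) :
    span R (Set.range (evenMonomials e)) ≤
      Subalgebra.toSubmodule (Algebra.adjoin R (Set.range e)) := by
  have h : ∀ i, e i ∈ Algebra.adjoin R (Set.range e) := fun i =>
    Algebra.subset_adjoin ⟨i, rfl⟩
  rw [span_le]
  rintro _ ⟨i, rfl⟩
  rw [SetLike.mem_coe, Subalgebra.mem_toSubmodule]
  fin_cases i
  · exact one_mem _
  · exact mul_mem (h 0) (h 1)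
  · exact mul_mem (h 0) (h 2)
  · exact mul_mem (h 1) (h 2)

theorem linearIndependent_evenMonomials {F : Type*} [Field F] [Algebra F A] [Nontrivial A]
    (h2 : (2 : F) ≠ 0) (e : Fin 3 → A) (a : Fin 3 → F) (ha : ∀ i, a i ≠ 0)
    (hq : ∀ i, e i * e i = a i • 1)
    (hb : ∀ i j, i ≠ j → e j * e i = - (e i * e j)) :
    LinearIndependent F (evenMonomials e) := by
  have hsq : ∀ i x, e i * (e i * x) = a i • x := fun i x => by
    rw [← mul_assoc, hq, smul_mul_assoc, one_mul]
  have hsw : ∀ i j, i ≠ j → ∀ x, e j * (e i * x) = - (e i * (e j * x)) := fun i j h x => by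
    rw [← mul_assoc, hb i j h, neg_mul, mul_assoc]
  have hone : ∀ c : F, c • (1 : A) = 0 → c = 0 := fun c h => by
    simpa using h
  have hcancel : ∀ i x, e i * x = 0 → x = 0 := fun i x h => by
    have := hsq i x
    rw [h, mul_zero] at this
    exact (smul_eq_zero.1 this.symm).resolve_left (ha i)
  rw [Fintype.linearIndependent_iff]
  intro g hg
  simp only [Fin.sum_univ_four, evenMonomials] at hg
  change g 0 • (1 : A) + g 1 • (e 0 * e 1) + g 2 • (e 0 * e 2) + g 3 • (e 1 * e 2) = 0 at hg
  have e0 : g 0 • e 0 - a 0 • g 1 • e 1 - a 0 • g 2 • e 2 + g 3 • (e 0 * (e 1 * e 2)) = 0 := by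
    have := congr_arg (· * e 0) hg
    simp only [add_mul, smul_mul_assoc, one_mul, zero_mul, mul_assoc, hb 0 1 (by decide),
      hb 0 2 (by decide), mul_neg, hsq, hsw 0 1 (by decide), neg_neg] at this
    rw [← this]
    simp only [smul_neg, smul_comm (a 0)]
    abel
  have e1 : g 0 • e 0 + a 0 • g 1 • e 1 + a 0 • g 2 • e 2 + g 3 • (e 0 * (e 1 * e 2)) = 0 := by
    have := congr_arg (e 0 * ·) hg
    simp only [mul_add, mul_smul_comm, mul_one, mul_zero, hsq] at this
    rw [← this]
    simp only [smul_comm (a 0)]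
  have e2 : (2 * a 0) • (g 1 • e 1 + g 2 • e 2) = 0 := by
    rw [mul_smul, two_smul, smul_add, ← sub_self (0 : A)]
    nth_rw 1 [← e1]
    rw [← e0]
    abel
  have e3 : g 1 • e 1 + g 2 • e 2 = 0 :=
    (smul_eq_zero.1 e2).resolve_left (mul_ne_zero h2 (ha 0))
  have e4 : g 0 • 1 + g 3 • (e 1 * e 2) = 0 := by
    have := congr_arg (e 0 * ·) e3
    simp only [mul_add, mul_smul_comm, mul_zero] at this
    rw [← hg, add_assoc (g 0 • (1 : A)), this, add_zero]
  have e5 : g 0 • 1 - g 3 • (e 1 * e 2) = 0 := by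
    refine hcancel 1 _ ?_
    have := congr_arg (· * e 1) e4
    simp only [add_mul, smul_mul_assoc, one_mul, zero_mul, mul_assoc, hb 1 2 (by decide),
      mul_neg] at this
    rw [← this, mul_sub, mul_smul_comm, mul_smul_comm, mul_one, smul_neg, sub_eq_add_neg]
  have g0 : g 0 = 0 := by
    have : (2 * g 0) • (1 : A) = 0 := by
      rw [mul_smul, two_smul]
      have := congr_arg₂ (· + ·) e4 e5
      simp only [add_zero] at this
      rw [← this]; abel
    exact (mul_eq_zero.1 (hone _ this)).resolve_left h2
  have g3 : g 3 = 0 := by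
    rw [g0, zero_smul, zero_add] at e4
    by_contra h
    have h1 := hcancel 1 _ ((smul_eq_zero.1 e4).resolve_left h)
    have := hq 2
    rw [h1, mul_zero] at this
    exact ha 2 (hone _ this.symm)
  have f1 : g 1 • e 1 - g 2 • e 2 = 0 := by
    refine hcancel 1 _ ?_
    have := congr_arg (· * e 1) e3
    simp only [add_mul, smul_mul_assoc, zero_mul, hb 1 2 (by decide), smul_neg] at this
    rw [← this, mul_sub, mul_smul_comm, mul_smul_comm, sub_eq_add_neg]
  have hne : ∀ i, e i ≠ 0 := fun i h => by
    have := hq i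
    rw [h, mul_zero] at this
    exact ha i (hone _ this.symm)
  have g1 : g 1 = 0 := by
    have : (2 * g 1) • e 1 = 0 := by
      rw [mul_smul, two_smul]
      have := congr_arg₂ (· + ·) e3 f1
      simp only [add_zero] at this
      rw [← this]; abel
    exact (mul_eq_zero.1 ((smul_eq_zero.1 this).resolve_right (hne 1))).resolve_left h2
  have g2 : g 2 = 0 := by
    rw [g1, zero_smul, zero_add] at e3
    exact (smul_eq_zero.1 e3).resolve_right (hne 2)
  intro i
  fin_cases i <;> assumption

end Monomials

section EvenClifford

variable {R F W : Type*} [CommRing R] [Field F] [Algebra R F]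
variable [AddCommGroup W] [Module F W] [Module R W] [IsScalarTower R F W]
variable {ψ : LinearMap.BilinForm F W}

local notation "Cl" => CliffordAlgebra (LinearMap.BilinMap.toQuadraticMap ψ)
local notation "cl" => CliffordAlgebra.ι (LinearMap.BilinMap.toQuadraticMap ψ)

theorem cliffordOrder_span (s : Set W) :
    cliffordOrder R F W (LinearMap.BilinMap.toQuadraticMap ψ) (span R s) =
      Algebra.adjoin R (cl '' s) := by
  have h : (cl '' (span R s : Set W)) = (span R (cl '' s) : Set Cl) := by
    have := Submodule.map_span ((cl).restrictScalars R) s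
    exact congr_arg SetLike.coe this
  rw [cliffordOrder, h, Algebra.adjoin_span]

theorem ι_mul_ι_self (x : W) : cl x * cl x = (ψ x x) • 1 := by
  rw [CliffordAlgebra.ι_sq_scalar, LinearMap.BilinMap.toQuadraticMap_apply,
    Algebra.algebraMap_eq_smul_one]

theorem ι_mul_ι_swap (hs : ψ.IsSymm) (x y : W) :
    cl y * cl x = (2 * ψ x y) • 1 - cl x * cl y := by
  have h : ψ y x = ψ x y := hs.eq y x
  rw [CliffordAlgebra.ι_mul_ι_comm, LinearMap.BilinMap.polar_toQuadraticMap, h, ← two_mul,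
    Algebra.algebraMap_eq_smul_one]

/-- The even part of the order of an integral lattice with basis `v` is spanned by the
even monomials in `v`. -/
theorem APlusSub_span_range (hs : ψ.IsSymm) (v : Fin 3 → W)
    (hv : ∀ x ∈ span R (Set.range v), ψ x x ∈ (algebraMap R F).range) :
    APlusSub R F W (LinearMap.BilinMap.toQuadraticMap ψ) (span R (Set.range v)) =
      span R (Set.range (evenMonomials fun i => cl (v i))) := by
  have hmem : ∀ i, v i ∈ span R (Set.range v) := fun i => subset_span ⟨i, rfl⟩
  have hq : ∀ i, ∃ q : R, cl (v i) * cl (v i) = q • 1 := fun i => by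
    obtain ⟨q, hq⟩ := hv _ (hmem i)
    exact ⟨q, by rw [ι_mul_ι_self, ← hq, algebraMap_smul]⟩
  have hb : ∀ i j, ∃ b : R, cl (v j) * cl (v i) = b • 1 - cl (v i) * cl (v j) := fun i j => by
    have h : 2 * ψ (v i) (v j) = ψ (v i + v j) (v i + v j) - ψ (v i) (v i) - ψ (v j) (v j) := by
      have : ψ (v j) (v i) = ψ (v i) (v j) := hs.eq _ _
      simp only [map_add, LinearMap.add_apply, this]
      ring
    have h' : 2 * ψ (v i) (v j) ∈ (algebraMap R F).range := by
      rw [h]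
      exact sub_mem (sub_mem (hv _ (add_mem (hmem i) (hmem j))) (hv _ (hmem i))) (hv _ (hmem j))
    obtain ⟨b, hb⟩ := h'
    exact ⟨b, by rw [ι_mul_ι_swap hs, ← hb, algebraMap_smul]⟩
  choose b hb using hb
  have hrange : cl '' Set.range v = Set.range fun i => cl (v i) := by
    rw [← Set.range_comp]; rfl
  have h1 := adjoin_le_span_monomials (fun i => cl (v i)) b hq hb
  have heven : span R (Set.range (evenMonomials fun i => cl (v i))) ≤
      Subalgebra.toSubmodule (evenR R F W (LinearMap.BilinMap.toQuadraticMap ψ)) := by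
    rw [span_le]
    rintro _ ⟨i, rfl⟩
    change _ ∈ CliffordAlgebra.evenOdd _ 0
    fin_cases i
    · exact SetLike.one_mem_graded _
    all_goals exact CliffordAlgebra.ι_mul_ι_mem_evenOdd_zero _ _ _
  have hodd : span R (Set.range (oddMonomials fun i => cl (v i))) ≤
      (CliffordAlgebra.evenOdd (LinearMap.BilinMap.toQuadraticMap ψ) 1).restrictScalars R := by
    rw [span_le]
    rintro _ ⟨i, rfl⟩
    rw [SetLike.mem_coe, restrictScalars_mem]
    fin_cases i
    · exact CliffordAlgebra.ι_mem_evenOdd_one _ _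
    · exact CliffordAlgebra.ι_mem_evenOdd_one _ _
    · exact CliffordAlgebra.ι_mem_evenOdd_one _ _
    · have := SetLike.mul_mem_graded (CliffordAlgebra.ι_mem_evenOdd_one
        (LinearMap.BilinMap.toQuadraticMap ψ) (v 0))
        (CliffordAlgebra.ι_mul_ι_mem_evenOdd_zero (LinearMap.BilinMap.toQuadraticMap ψ)
          (v 1) (v 2))
      rwa [add_zero] at this
  rw [APlusSub, APlus, cliffordOrder_span, hrange]
  apply le_antisymm
  · rintro x ⟨hx0, hx⟩
    obtain ⟨p, hp, q, hq, rfl⟩ := mem_sup.1 (h1 hx)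
    have hq0 : q ∈ CliffordAlgebra.evenOdd (LinearMap.BilinMap.toQuadraticMap ψ) 0 := by
      have : (p + q) - p ∈ CliffordAlgebra.evenOdd (LinearMap.BilinMap.toQuadraticMap ψ) 0 :=
        sub_mem hx0 (heven hp)
      simpa using this
    have := disjoint_def.1 (CliffordAlgebra.evenOdd_isCompl
      (LinearMap.BilinMap.toQuadraticMap ψ)).disjoint q hq0 (hodd hq)
    rw [this, add_zero]
    exact hp
  · exact fun x hx => ⟨heven hx, span_evenMonomials_le_adjoin _ hx⟩

theorem even_eq_span (hs : ψ.IsSymm) (v : Basis (Fin 3) F W) :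
    Subalgebra.toSubmodule (CliffordAlgebra.even (LinearMap.BilinMap.toQuadraticMap ψ)) =
      span F (Set.range (evenMonomials fun i => cl (v i))) := by
  rw [← APlusSub_span_range hs v fun x _ => ⟨_, rfl⟩]
  ext x
  refine ⟨fun h => ⟨h, ?_⟩, fun h => h.1⟩
  rw [v.span_eq]
  change x ∈ Algebra.adjoin F (cl '' Set.univ)
  rw [Set.image_univ, CliffordAlgebra.adjoin_range_ι]
  trivial

theorem linearIndependent_evenMonomials_ι (h2 : (2 : F) ≠ 0) (hs : ψ.IsSymm)
    (hψ : ψ.Nondegenerate) (v : Basis (Fin 3) F W) :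
    LinearIndependent F (evenMonomials fun i => cl (v i)) := by
  let : Invertible (2 : F) := invertibleOfNonzero h2
  have : FiniteDimensional F W := v.finiteDimensional_of_finite
  obtain ⟨w', hw'⟩ := LinearMap.BilinForm.exists_orthogonal_basis (B := ψ)
    (LinearMap.BilinForm.isSymm_iff.1 hs)
  have hn : finrank F W = 3 := by simpa using finrank_eq_card_basis v
  let w := w'.reindex (finCongr hn)
  have hw : ∀ i j, i ≠ j → ψ (w i) (w j) = 0 := fun i j hij => by
    have := LinearMap.isOrthoᵢ_def.1 hw' ((finCongr hn).symm i) ((finCongr hn).symm j)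
      (by simpa using hij)
    simpa [w] using this
  have hwi : LinearIndependent F (evenMonomials fun i => cl (w i)) := by
    refine linearIndependent_evenMonomials h2 _ (fun i => ψ (w i) (w i)) (fun i h => ?_)
      (fun i => ι_mul_ι_self _) (fun i j hij => ?_)
    · refine w.ne_zero i (hψ.1 _ fun y => ?_)
      rw [← w.sum_repr y, map_sum]
      refine Finset.sum_eq_zero fun j _ => ?_
      by_cases hij : i = j
      · subst hij; simp [h]
      · simp [hw i j hij]
    · rw [ι_mul_ι_swap hs, hw i j hij]; simp
  have hspan : span F (Set.range (evenMonomials fun i => cl (v i))) =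
      span F (Set.range (evenMonomials fun i => cl (w i))) := by
    rw [← even_eq_span hs, ← even_eq_span hs]
  rw [linearIndependent_iff_card_eq_finrank_span, Set.finrank, hspan,
    finrank_span_eq_card hwi]

/-- The basis of the even Clifford algebra given by the even monomials in a basis. -/
def evenBasis (h2 : (2 : F) ≠ 0) (hs : ψ.IsSymm) (hψ : ψ.Nondegenerate)
    (v : Basis (Fin 3) F W) :
    Basis (Fin 4) F
      (Subalgebra.toSubmodule (CliffordAlgebra.even (LinearMap.BilinMap.toQuadraticMap ψ))) :=
  (Basis.span (linearIndependent_evenMonomials_ι h2 hs hψ v)).map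
    (LinearEquiv.ofEq _ _ (even_eq_span hs v).symm)

theorem coe_evenBasis (h2 : (2 : F) ≠ 0) (hs : ψ.IsSymm) (hψ : ψ.Nondegenerate)
    (v : Basis (Fin 3) F W) (i : Fin 4) :
    (evenBasis h2 hs hψ v i : Cl) = evenMonomials (fun i => cl (v i)) i := by
  rw [evenBasis, Basis.map_apply, LinearEquiv.coe_ofEq_apply, Basis.span_apply]

theorem det_evenBasis (h2 : (2 : F) ≠ 0) (hs : ψ.IsSymm) (hψ : ψ.Nondegenerate)
    (v w : Basis (Fin 3) F W) :
    (evenBasis h2 hs hψ v).det (evenBasis h2 hs hψ w) = v.det w * v.det w := by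
  set A := v.toMatrix w with hA
  have hw : ∀ j, cl (w j) = A 0 j • cl (v 0) + A 1 j • cl (v 1) + A 2 j • cl (v 2) := by
    intro j
    conv_lhs => rw [← v.sum_repr (w j)]
    rw [Fin.sum_univ_three]
    simp [hA, Basis.toMatrix_apply]
  have hprod : ∀ j k, ∃ c : F, cl (w j) * cl (w k) = c • 1 +
      (A 0 j * A 1 k - A 1 j * A 0 k) • (cl (v 0) * cl (v 1)) +
      (A 0 j * A 2 k - A 2 j * A 0 k) • (cl (v 0) * cl (v 2)) +
      (A 1 j * A 2 k - A 2 j * A 1 k) • (cl (v 1) * cl (v 2)) := by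
    intro j k
    refine ⟨A 0 j * A 0 k * ψ (v 0) (v 0) + A 1 j * A 1 k * ψ (v 1) (v 1) +
      A 2 j * A 2 k * ψ (v 2) (v 2) + A 1 j * A 0 k * (2 * ψ (v 0) (v 1)) +
      A 2 j * A 0 k * (2 * ψ (v 0) (v 2)) + A 2 j * A 1 k * (2 * ψ (v 1) (v 2)), ?_⟩
    rw [hw j, hw k]
    simp only [add_mul, mul_add, smul_mul_smul_comm, ι_mul_ι_self, ι_mul_ι_swap hs (v 0) (v 1),
      ι_mul_ι_swap hs (v 0) (v 2), ι_mul_ι_swap hs (v 1) (v 2)]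
    module
  choose c hc using hprod
  let T : Matrix (Fin 4) (Fin 4) F := Matrix.of fun i j =>
    (![![1, 0, 0, 0],
      ![c 0 1, A 0 0 * A 1 1 - A 1 0 * A 0 1, A 0 0 * A 2 1 - A 2 0 * A 0 1,
        A 1 0 * A 2 1 - A 2 0 * A 1 1],
      ![c 0 2, A 0 0 * A 1 2 - A 1 0 * A 0 2, A 0 0 * A 2 2 - A 2 0 * A 0 2,
        A 1 0 * A 2 2 - A 2 0 * A 1 2],
      ![c 1 2, A 0 1 * A 1 2 - A 1 1 * A 0 2, A 0 1 * A 2 2 - A 2 1 * A 0 2,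
        A 1 1 * A 2 2 - A 2 1 * A 1 2]] : Fin 4 → Fin 4 → F) j i
  have hT : (evenBasis h2 hs hψ v).toMatrix (evenBasis h2 hs hψ w) = T := by
    ext i j
    have : evenBasis h2 hs hψ w j = ∑ k, T k j • evenBasis h2 hs hψ v k := by
      apply Subtype.ext
      rw [Fin.sum_univ_four]
      simp only [coe_add, coe_smul, coe_evenBasis]
      fin_cases j
      · simp [T, evenMonomials]
      · simpa [T, evenMonomials] using hc 0 1
      · simpa [T, evenMonomials] using hc 0 2
      · simpa [T, evenMonomials] using hc 1 2
    rw [Basis.toMatrix_apply, this, Basis.repr_sum_self]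
  rw [Basis.det_apply, Basis.det_apply, hT, ← hA, Matrix.det_fin_three]
  simp [T, Matrix.det_succ_row_zero, Fin.sum_univ_succ, Fin.succAbove]
  ring

end EvenClifford

section Finiteness

variable {R A : Type*} [CommRing R] [IsNoetherianRing R] [Ring A] [Algebra R A]

theorem fg_adjoin_of_quadratic_relations (s : Set A) (hs : s.Finite)
    (hq : ∀ x ∈ s, ∃ q : R, x * x = q • 1)
    (hb : ∀ x ∈ s, ∀ y ∈ s, ∃ b : R, y * x = b • 1 - x * y) :
    (Subalgebra.toSubmodule (Algebra.adjoin R s)).FG := by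
  induction s, hs using Set.Finite.induction_on with
  | empty =>
    rw [Algebra.adjoin_empty, Algebra.toSubmodule_bot, one_eq_span]
    exact fg_span_singleton 1
  | @insert x t _ _ ih =>
    have hA := ih (fun y hy => hq y (Or.inr hy)) fun y hy z hz => hb y (Or.inr hy) z (Or.inr hz)
    set A₀ := Algebra.adjoin R t with hA₀
    set K := Subalgebra.toSubmodule A₀ ⊔
      (Subalgebra.toSubmodule A₀).map (LinearMap.mulLeft R x) with hK
    have hKfg : K.FG := hA.sup (hA.map _)
    have hl : ∀ a ∈ A₀, a ∈ K := fun a ha => mem_sup_left ha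
    have hr : ∀ a ∈ A₀, x * a ∈ K := fun a ha => mem_sup_right ⟨a, ha, rfl⟩
    have hle : Subalgebra.toSubmodule (Algebra.adjoin R (insert x t)) ≤ K := by
      intro y hy
      suffices h : ∀ k ∈ K, y * k ∈ K by simpa using h 1 (hl 1 (one_mem _))
      rw [Subalgebra.mem_toSubmodule] at hy
      induction hy using Algebra.adjoin_induction with
      | algebraMap r => intro k hk; rw [← Algebra.smul_def]; exact K.smul_mem _ hk
      | add x y _ _ hx hy => intro k hk; rw [add_mul]; exact add_mem (hx k hk) (hy k hk)
      | mul x y _ _ hx hy => intro k hk; rw [mul_assoc]; exact hx _ (hy k hk)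
      | mem y hy =>
        intro k hk
        obtain ⟨a, ha, _, ⟨c, hc, rfl⟩, rfl⟩ := mem_sup.1 hk
        rw [LinearMap.mulLeft_apply, mul_add, ← mul_assoc]
        rcases hy with rfl | hy
        · obtain ⟨q, hq⟩ := hq y (Or.inl rfl)
          rw [hq, smul_mul_assoc, one_mul]
          exact add_mem (hr a ha) (K.smul_mem _ (hl c hc))
        · have hyA : y ∈ A₀ := Algebra.subset_adjoin hy
          obtain ⟨b, hb⟩ := hb x (Or.inl rfl) y (Or.inr hy)
          rw [hb, sub_mul, smul_mul_assoc, one_mul, mul_assoc]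
          exact add_mem (hl _ (mul_mem hyA ha))
            (sub_mem (K.smul_mem _ (hl c hc)) (hr _ (mul_mem hyA hc)))
    have : IsNoetherian R K := isNoetherian_of_fg_of_noetherian K hKfg
    exact isNoetherian_submodule.1 this _ hle

end Finiteness

section Localization

variable {R O F V : Type*} [CommRing R] [CommRing O] [Field F] [Algebra R O] [Algebra O F]
  [Algebra R F] [IsScalarTower R O F] (S : Submonoid R) [IsLocalization S O]
variable [AddCommGroup V] [Module F V] [Module R V] [Module O V] [IsScalarTower R F V]
  [IsScalarTower O F V] [IsScalarTower R O V]

include S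

omit [Module F V] [IsScalarTower R F V] [IsScalarTower O F V] in
theorem mem_span_localization {L : Submodule R V} {x : V} :
    x ∈ span O (L : Set V) ↔ ∃ s ∈ S, s • x ∈ L := by
  constructor
  · intro hx
    induction hx using span_induction with
    | mem x hx => exact ⟨1, S.one_mem, by simpa using hx⟩
    | zero => exact ⟨1, S.one_mem, by simp⟩
    | add x y _ _ hx hy =>
      obtain ⟨s, hs, hx⟩ := hx
      obtain ⟨t, ht, hy⟩ := hy
      refine ⟨s * t, S.mul_mem hs ht, ?_⟩
      rw [smul_add]
      refine add_mem ?_ ?_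
      · rw [mul_comm, mul_smul]; exact L.smul_mem _ hx
      · rw [mul_smul]; exact L.smul_mem _ hy
    | smul a x _ hx =>
      obtain ⟨s, hs, hx⟩ := hx
      obtain ⟨⟨r, t⟩, hr⟩ := IsLocalization.surj S a
      refine ⟨t * s, S.mul_mem t.2 hs, ?_⟩
      have : ((t : R) * s) • a • x = r • s • x := by
        rw [← algebraMap_smul O ((t : R) * s), ← algebraMap_smul O r (s • x),
          ← algebraMap_smul O s x, smul_smul, smul_smul, map_mul, ← hr]
        congr 1
        ring
      rw [this]
      exact L.smul_mem _ hx
  · rintro ⟨s, hs, hx⟩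
    have hu : IsUnit (algebraMap R O s) := IsLocalization.map_units O ⟨s, hs⟩
    obtain ⟨u, hu⟩ := hu
    have : x = (↑u⁻¹ : O) • s • x := by
      rw [← algebraMap_smul O s x, smul_smul, ← hu, Units.inv_mul, one_smul]
    rw [this]
    exact smul_mem _ _ (subset_span hx)

omit [Module F V] [IsScalarTower R F V] [IsScalarTower O F V] in
theorem exists_forall_smul_mem_of_fg {L M : Submodule R V} (hL : L.FG) (f : V →ₗ[R] V)
    (hf : ∀ x ∈ L, f x ∈ span O (M : Set V)) : ∃ s ∈ S, ∀ x ∈ L, s • f x ∈ M := by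
  induction L, hL using Submodule.fg_induction with
  | singleton y =>
    obtain ⟨s, hs, h⟩ := (mem_span_localization S).1 (hf y (mem_span_singleton_self y))
    refine ⟨s, hs, fun x hx => ?_⟩
    obtain ⟨r, rfl⟩ := mem_span_singleton.1 hx
    rw [map_smul, smul_comm]
    exact M.smul_mem _ h
  | sup L₁ L₂ _ _ h₁ h₂ =>
    obtain ⟨s, hs, h₁⟩ := h₁ fun x hx => hf x (mem_sup_left hx)
    obtain ⟨t, ht, h₂⟩ := h₂ fun x hx => hf x (mem_sup_right hx)
    refine ⟨s * t, S.mul_mem hs ht, fun x hx => ?_⟩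
    obtain ⟨a, ha, b, hb, rfl⟩ := mem_sup.1 hx
    rw [map_add, smul_add]
    refine add_mem ?_ ?_
    · rw [mul_comm, mul_smul]; exact M.smul_mem _ (h₁ a ha)
    · rw [mul_smul]; exact M.smul_mem _ (h₂ b hb)

theorem latIdx_localization (hS : ∀ s ∈ S, algebraMap R F s ≠ 0) {L M : Submodule R V}
    (hL : L.FG) :
    latIdx O F V (span O (L : Set V)) (span O (M : Set V)) =
      span O (latIdx R F V L M : Set F) := by
  apply le_antisymm
  · rw [latIdx, span_le]
    rintro d ⟨α, hα, rfl⟩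
    obtain ⟨s, hs, h⟩ := exists_forall_smul_mem_of_fg S hL
      ((α : V →ₗ[F] V).restrictScalars R) fun x hx => hα x (subset_span hx)
    rw [SetLike.mem_coe, mem_span_localization S]
    refine ⟨s ^ finrank F V, S.pow_mem hs _, ?_⟩
    refine subset_span ⟨(LinearEquiv.smulOfNeZero F V _ (hS s hs)).trans α |>.trans
      (LinearEquiv.refl F V), ?_, ?_⟩
    · intro x hx
      have : α (algebraMap R F s • x) = s • α x := by rw [map_smul, algebraMap_smul]
      change α (algebraMap R F s • x) ∈ M
      rw [this]
      exact h x hx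
    · rw [Algebra.smul_def, map_pow, ← LinearMap.det_smul]
      congr 1
      ext x
      change α (algebraMap R F s • x) = algebraMap R F s • α x
      rw [map_smul]
  · rw [span_le]
    suffices h : latIdx R F V L M ≤
        (latIdx O F V (span O (L : Set V)) (span O (M : Set V))).restrictScalars R from h
    rw [latIdx, span_le]
    rintro d ⟨α, hα, rfl⟩
    refine subset_span ⟨α, fun x hx => ?_, rfl⟩
    induction hx using span_induction with
    | mem x hx => exact subset_span (hα x hx)
    | zero => simp
    | add x y _ _ hx hy => rw [map_add]; exact add_mem hx hy
    | smul a x _ hx =>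
      rw [← algebraMap_smul F, map_smul, algebraMap_smul]; exact smul_mem _ _ hx

omit S [IsLocalization S O] [Algebra R F] [IsScalarTower R O F] [IsScalarTower R F V] in
theorem IsLat.localization {L : Submodule R V} (hL : IsLat R F V L) :
    IsLat O F V (span O (L : Set V)) := by
  obtain ⟨⟨s, rfl⟩, h⟩ := hL
  refine ⟨⟨s, by rw [span_span_of_tower]⟩, by rw [span_span_of_tower]; exact h⟩

omit [IsScalarTower R F V] in
theorem IsIntegralLat.localization {ψ : LinearMap.BilinForm F V} {L : Submodule R V}
    (hL : IsIntegralLat R F V ψ L) : IsIntegralLat O F V ψ (span O (L : Set V)) := by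
  refine ⟨hL.1.localization, fun x hx => ?_⟩
  obtain ⟨s, hs, h⟩ := (mem_span_localization S).1 hx
  obtain ⟨r, hr⟩ := hL.2 _ h
  have hu : IsUnit (algebraMap R O s) := IsLocalization.map_units O ⟨s, hs⟩
  obtain ⟨u, hu⟩ := hu
  refine ⟨u⁻¹ * u⁻¹ * algebraMap R O r, ?_⟩
  have h1 : x = (↑u⁻¹ : O) • s • x := by
    rw [← algebraMap_smul O s x, smul_smul, ← hu, Units.inv_mul, one_smul]
  conv_rhs => rw [h1, ← algebraMap_smul F (↑u⁻¹ : O)]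
  rw [map_mul, map_mul, ← IsScalarTower.algebraMap_apply, hr]
  simp only [map_smul, LinearMap.smul_apply, smul_eq_mul]
  ring

theorem IsMaximalLat.localization {ψ : LinearMap.BilinForm F V} (hψ : ψ.IsSymm)
    {M : Submodule R V} (hM : IsMaximalLat R F V ψ M) :
    IsMaximalLat O F V ψ (span O (M : Set V)) := by
  refine ⟨hM.1.localization S, fun L' hL' hle => le_antisymm (fun x hx => ?_) hle⟩
  have hmemF : ∀ a ∈ (algebraMap O F).range, ∃ s ∈ S, s • a ∈ (1 : Submodule R F) := by
    rintro _ ⟨a, rfl⟩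
    obtain ⟨⟨r, t⟩, hr⟩ := IsLocalization.surj S a
    refine ⟨t, t.2, mem_one.2 ⟨r, ?_⟩⟩
    rw [Algebra.smul_def, IsScalarTower.algebraMap_apply R O F,
      IsScalarTower.algebraMap_apply R O F, ← map_mul, ← hr, mul_comm]
  obtain ⟨s, hs, h⟩ := hmemF _ (hL'.2 x hx)
  have hpair : ∃ t ∈ S, ∀ y ∈ M, t • (2 * ψ x y) ∈ (1 : Submodule R F) := by
    have : ∀ y ∈ L', ∃ t ∈ S, t • (2 * ψ x y) ∈ (1 : Submodule R F) := fun y hy =>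
      hmemF _ (hL'.two_mul_mem hψ hx hy)
    have hMg : ∀ K : Submodule R V, K.FG → K ≤ M →
        ∃ t ∈ S, ∀ y ∈ K, t • (2 * ψ x y) ∈ (1 : Submodule R F) := by
      intro K hK
      induction K, hK using Submodule.fg_induction with
      | singleton y =>
        intro hy
        obtain ⟨t, ht, h⟩ := this y (hle (subset_span (hy (mem_span_singleton_self y))))
        refine ⟨t, ht, fun z hz => ?_⟩
        obtain ⟨r, rfl⟩ := mem_span_singleton.1 hz
        have : t • (2 * ψ x (r • y)) = r • t • (2 * ψ x y) := by
          rw [← algebraMap_smul F r y, map_smul, smul_eq_mul, mul_left_comm, ← Algebra.smul_def,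
            smul_comm]
        rw [this]
        exact smul_mem _ _ h
      | sup L₁ L₂ _ _ h₁ h₂ =>
        intro hy
        obtain ⟨s, hs, h₁⟩ := h₁ (le_sup_left.trans hy)
        obtain ⟨t, ht, h₂⟩ := h₂ (le_sup_right.trans hy)
        refine ⟨s * t, S.mul_mem hs ht, fun z hz => ?_⟩
        obtain ⟨a, ha, b, hb, rfl⟩ := mem_sup.1 hz
        rw [map_add, mul_add, smul_add]
        refine add_mem ?_ ?_
        · rw [mul_comm s, mul_smul]; exact smul_mem _ _ (h₁ a ha)
        · rw [mul_smul]; exact smul_mem _ _ (h₂ b hb)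
    exact hMg M hM.1.1.1 le_rfl
  obtain ⟨t, ht, ht'⟩ := hpair
  rw [mem_span_localization S]
  refine ⟨s * t, S.mul_mem hs ht, hM.mem_of_forall hψ ?_ fun y hy => ?_⟩
  · obtain ⟨r, hr⟩ := mem_one.1 h
    refine ⟨s * t * t * r, ?_⟩
    rw [map_mul, hr, ← algebraMap_smul F (s * t) x, Algebra.smul_def]
    simp only [map_smul, LinearMap.smul_apply, smul_eq_mul, map_mul]
    ring
  · obtain ⟨r, hr⟩ := mem_one.1 (ht' y hy)
    refine ⟨s * r, ?_⟩
    rw [map_mul, hr, ← algebraMap_smul F (s * t) x, Algebra.smul_def]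
    simp only [map_smul, LinearMap.smul_apply, smul_eq_mul, map_mul]
    ring

omit [IsScalarTower R O V] in
theorem APlusSub_localization {ψ : LinearMap.BilinForm F V} (N : Submodule R V) :
    APlusSub O F V (LinearMap.BilinMap.toQuadraticMap ψ) (span O (N : Set V)) =
      span O (APlusSub R F V (LinearMap.BilinMap.toQuadraticMap ψ) N :
        Set (CliffordAlgebra (LinearMap.BilinMap.toQuadraticMap ψ))) := by
  have h : Subalgebra.toSubmodule (cliffordOrder O F V (LinearMap.BilinMap.toQuadraticMap ψ)
      (span O (N : Set V))) = span O (Subalgebra.toSubmodule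
        (cliffordOrder R F V (LinearMap.BilinMap.toQuadraticMap ψ) N) :
          Set (CliffordAlgebra (LinearMap.BilinMap.toQuadraticMap ψ))) := by
    rw [cliffordOrder_span, cliffordOrder, Algebra.adjoin_eq_span, Algebra.adjoin_eq_span,
      span_span_of_tower]
  ext x
  rw [mem_span_localization S]
  have h1 : x ∈ cliffordOrder O F V (LinearMap.BilinMap.toQuadraticMap ψ) (span O (N : Set V)) ↔
      ∃ s ∈ S, s • x ∈ cliffordOrder R F V (LinearMap.BilinMap.toQuadraticMap ψ) N := by
    rw [← Subalgebra.mem_toSubmodule, h, mem_span_localization S]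
    rfl
  constructor
  · rintro ⟨hx, hx'⟩
    obtain ⟨s, hs, h⟩ := h1.1 hx'
    exact ⟨s, hs, (evenR R F V _).smul_mem hx s, h⟩
  · rintro ⟨s, hs, hx, hx'⟩
    refine ⟨?_, h1.2 ⟨s, hs, hx'⟩⟩
    have : x ∈ span O ((Subalgebra.toSubmodule (evenR R F V
        (LinearMap.BilinMap.toQuadraticMap ψ))) : Set (CliffordAlgebra _)) :=
      (mem_span_localization S).2 ⟨s, hs, hx⟩
    refine (span_le (p := Subalgebra.toSubmodule (evenR O F V _))).2 ?_ this
    exact fun y hy => hy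

end Localization

section Local

variable {O F W : Type*} [CommRing O] [Field F] [Algebra O F] [IsFractionRing O F]
  [AddCommGroup W] [Module F W] [Module O W] [IsScalarTower O F W]
  {ψ : LinearMap.BilinForm F W}

omit [IsFractionRing O F] in
theorem comap_subtype_APlusSub_span_range (h2 : (2 : F) ≠ 0) (hs : ψ.IsSymm)
    (hψ : ψ.Nondegenerate) (v : Basis (Fin 3) F W)
    (hv : ∀ x ∈ span O (Set.range v), ψ x x ∈ (algebraMap O F).range) :
    (APlusSub O F W (LinearMap.BilinMap.toQuadraticMap ψ) (span O (Set.range v))).comap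
      ((Subalgebra.toSubmodule (CliffordAlgebra.even
        (LinearMap.BilinMap.toQuadraticMap ψ))).subtype.restrictScalars O) =
      span O (Set.range (evenBasis h2 hs hψ v)) := by
  rw [APlusSub_span_range hs v hv]
  set f := (Subalgebra.toSubmodule (CliffordAlgebra.even
        (LinearMap.BilinMap.toQuadraticMap ψ))).subtype.restrictScalars O
  have hf : Function.Injective f := Subtype.val_injective
  have : Set.range (evenMonomials fun i =>
      CliffordAlgebra.ι (LinearMap.BilinMap.toQuadraticMap ψ) (v i)) =
      f '' Set.range (evenBasis h2 hs hψ v) := by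
    rw [← Set.range_comp]
    congr 1
    ext i
    exact (coe_evenBasis h2 hs hψ v i).symm
  rw [this, ← map_span, comap_map_eq_of_injective hf]

theorem APlusIdx_eq_of_isPrincipalIdealRing [IsDomain O] [IsPrincipalIdealRing O]
    (h2 : (2 : F) ≠ 0) (hs : ψ.IsSymm) (hψ : ψ.Nondegenerate) (hW : finrank F W = 3)
    {M N : Submodule O W} (hM : IsIntegralLat O F W ψ M) (hN : IsIntegralLat O F W ψ N) :
    APlusIdx O F W ψ M N = latIdx O F W M N * latIdx O F W M N := by
  obtain ⟨v, rfl⟩ := hM.1.exists_basis hW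
  obtain ⟨w, rfl⟩ := hN.1.exists_basis hW
  rw [APlusIdx, latIdxIn, comap_subtype_APlusSub_span_range h2 hs hψ v hM.2,
    comap_subtype_APlusSub_span_range h2 hs hψ w hN.2, latIdx_span_range, latIdx_span_range,
    det_evenBasis, span_mul_span, Set.singleton_mul_singleton]

end Local

section Globalization

variable {R O F V : Type*} [CommRing R] [CommRing O] [Field F] [Algebra R O] [Algebra O F]
  [Algebra R F] [IsScalarTower R O F]

theorem span_localization_mul (I J : Submodule R F) :
    span O ((I * J : Submodule R F) : Set F) = span O (I : Set F) * span O (J : Set F) := by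
  rw [mul_eq_span_mul_set, span_span_of_tower, span_mul_span]

omit [IsScalarTower R O F] in
theorem comap_span_localization (S : Submonoid R) [IsLocalization S O] [AddCommGroup V]
    [Module F V] [Module R V] [Module O V] [IsScalarTower R F V]
    [IsScalarTower O F V] [IsScalarTower R O V] (U : Submodule F V) (P : Submodule R V) :
    (span O (P : Set V)).comap (U.subtype.restrictScalars O) =
      span O (P.comap (U.subtype.restrictScalars R) : Set U) := by
  have : IsScalarTower R O U := ⟨fun a b c => Subtype.ext (smul_assoc a b (c : V))⟩
  ext x
  rw [mem_span_localization S, mem_comap, mem_span_localization S]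
  rfl

theorem fg_comap_subtype_APlusSub [IsNoetherianRing R] [AddCommGroup V] [Module F V]
    [Module R V] [IsScalarTower R F V] {ψ : LinearMap.BilinForm F V} (hs : ψ.IsSymm)
    {N : Submodule R V} (hN : IsIntegralLat R F V ψ N)
    (U : Submodule F (CliffordAlgebra (LinearMap.BilinMap.toQuadraticMap ψ))) :
    ((APlusSub R F V (LinearMap.BilinMap.toQuadraticMap ψ) N).comap
      (U.subtype.restrictScalars R)).FG := by
  have hfg : (Subalgebra.toSubmodule
      (cliffordOrder R F V (LinearMap.BilinMap.toQuadraticMap ψ) N)).FG := by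
    obtain ⟨s, hs'⟩ := hN.1.1
    have hsN : ∀ x ∈ s, x ∈ N := fun x hx => hs' ▸ subset_span hx
    rw [← hs', cliffordOrder_span]
    apply fg_adjoin_of_quadratic_relations _ (s.finite_toSet.image _)
    · rintro _ ⟨x, hx, rfl⟩
      obtain ⟨q, hq⟩ := hN.2 x (hsN x hx)
      exact ⟨q, by rw [ι_mul_ι_self, ← hq, algebraMap_smul]⟩
    · rintro _ ⟨x, hx, rfl⟩ _ ⟨y, hy, rfl⟩
      obtain ⟨b, hb⟩ := hN.two_mul_mem hs (hsN x hx) (hsN y hy)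
      exact ⟨b, by rw [ι_mul_ι_swap hs, ← hb, algebraMap_smul]⟩
  have := isNoetherian_of_fg_of_noetherian _ hfg
  refine fg_of_fg_map_injective (U.subtype.restrictScalars R) Subtype.val_injective ?_
  exact isNoetherian_submodule.1 this _ ((map_comap_le _ _).trans fun x hx => hx.2)

end Globalization

section Dedekind

variable {R F W : Type*} [CommRing R] [IsDedekindDomain R] [Field F] [Algebra R F]
  [IsFractionRing R F]

/-- The localization of `R` at a prime ideal, inside the field of fractions. -/
abbrev localRing (p : Ideal R) [p.IsPrime] : Subalgebra R F :=
  Localization.subalgebra.ofField F p.primeCompl p.primeCompl_le_nonZeroDivisors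

instance (p : Ideal R) [p.IsPrime] : IsLocalization p.primeCompl (localRing (F := F) p) :=
  Localization.subalgebra.isLocalization_ofField F p.primeCompl p.primeCompl_le_nonZeroDivisors

instance (p : Ideal R) [p.IsPrime] : IsFractionRing (localRing (F := F) p) F :=
  Localization.subalgebra.isFractionRing_ofField F p.primeCompl p.primeCompl_le_nonZeroDivisors

theorem isDiscreteValuationRing_localRing (hR : ¬ IsField R) (p : Ideal R) [p.IsMaximal] :
    IsDiscreteValuationRing (localRing (F := F) p) :=
  IsLocalization.AtPrime.isDiscreteValuationRing_of_dedekind_domain R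
    (Ring.ne_bot_of_isMaximal_of_not_isField ‹_› hR) _

theorem le_of_forall_span_localRing_le {I J : Submodule R F}
    (h : ∀ (p : Ideal R) [p.IsMaximal],
      span (localRing (F := F) p) (I : Set F) ≤ span (localRing (F := F) p) (J : Set F)) :
    I ≤ J := by
  intro x hx
  by_contra hxJ
  obtain ⟨p, hp, hle⟩ := Ideal.exists_le_maximal (J.comap (LinearMap.toSpanSingleton R F x))
    ((Ideal.ne_top_iff_one _).2 (by simpa using hxJ))
  obtain ⟨s, hs, hsx⟩ := (mem_span_localization p.primeCompl).1 (h p (subset_span hx))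
  exact hs (hle (by simpa using hsx))

theorem eq_of_forall_span_localRing_eq {I J : Submodule R F}
    (h : ∀ (p : Ideal R) [p.IsMaximal],
      span (localRing (F := F) p) (I : Set F) = span (localRing (F := F) p) (J : Set F)) :
    I = J :=
  le_antisymm (le_of_forall_span_localRing_le fun p _ => (h p).le)
    (le_of_forall_span_localRing_le fun p _ => (h p).ge)

variable [AddCommGroup W] [Module F W] [Module R W] [IsScalarTower R F W]
  {ψ : LinearMap.BilinForm F W}

theorem algebraMap_ne_zero_of_mem_primeCompl (p : Ideal R) [p.IsPrime] :
    ∀ s ∈ p.primeCompl, algebraMap R F s ≠ 0 := fun _ hs =>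
  IsFractionRing.to_map_ne_zero_of_mem_nonZeroDivisors (p.primeCompl_le_nonZeroDivisors hs)

instance (p : Ideal R) [p.IsPrime] : IsScalarTower R (localRing (F := F) p) W :=
  ⟨fun a b c => by
    change (a • (b : F)) • c = a • ((b : F) • c)
    rw [smul_assoc]⟩

/-- All maximal lattices have the same index relative to a given lattice. -/
theorem IsMaximalLat.latIdx_eq_of_isDedekindDomain (hR : ¬ IsField R) [FiniteDimensional F W]
    (h2 : (2 : F) ≠ 0) (hs : ψ.IsSymm) (hψ : ψ.Nondegenerate) {M M' N : Submodule R W}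
    (hM : IsMaximalLat R F W ψ M) (hM' : IsMaximalLat R F W ψ M') (hN : IsLat R F W N) :
    latIdx R F W M N = latIdx R F W M' N := by
  refine eq_of_forall_span_localRing_eq fun p _ => ?_
  have := isDiscreteValuationRing_localRing (F := F) hR p
  have hp := algebraMap_ne_zero_of_mem_primeCompl (F := F) p
  rw [← latIdx_localization p.primeCompl hp hM.1.1.1,
    ← latIdx_localization p.primeCompl hp hM'.1.1.1]
  exact (hM.localization p.primeCompl hs).latIdx_eq h2 hs hψ (hM'.localization p.primeCompl hs)
    hN.localization

/-- In a ternary space, `[A⁺(M)/A⁺(N)] = [M/N]²` for all integral lattices `M` and `N`. -/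
theorem APlusIdx_eq_latIdx_mul_latIdx (hR : ¬ IsField R)
    (h2 : (2 : F) ≠ 0) (hs : ψ.IsSymm) (hψ : ψ.Nondegenerate) (hW : finrank F W = 3)
    {M N : Submodule R W} (hM : IsIntegralLat R F W ψ M) (hN : IsIntegralLat R F W ψ N) :
    APlusIdx R F W ψ M N = latIdx R F W M N * latIdx R F W M N := by
  refine eq_of_forall_span_localRing_eq fun p _ => ?_
  have := isDiscreteValuationRing_localRing (F := F) hR p
  have hp := algebraMap_ne_zero_of_mem_primeCompl (F := F) p
  have key := APlusIdx_eq_of_isPrincipalIdealRing h2 hs hψ hW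
    (hM.localization (O := localRing (F := F) p) p.primeCompl)
    (hN.localization (O := localRing (F := F) p) p.primeCompl)
  rw [span_localization_mul, ← latIdx_localization p.primeCompl hp hM.1.1, ← key,
    APlusIdx, latIdxIn, ← latIdx_localization p.primeCompl hp (fg_comap_subtype_APlusSub hs hM _),
    APlusIdx, latIdxIn, APlusSub_localization p.primeCompl, APlusSub_localization p.primeCompl,
    comap_span_localization p.primeCompl, comap_span_localization p.primeCompl]
  rfl

end Dedekind

end Paper

open Paper NumberField

/-- For an integral lattice `N` and maximal lattices `M, M'` in a
nondegenerate ternary quadratic space `(W,ψ)` over a number field `F`, the ideal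
`[A⁺(M)/A⁺(N)]` (computed inside the quaternion algebra `A⁺(W)`) is independent of
the choice of the maximal lattice `M`, and `[A⁺(M)/A⁺(N)] = [M/N]²`. -/
theorem statement0
    (F : Type*) [Field F] [NumberField F]
    (W : Type*) [AddCommGroup W] [Module F W]
    [Module (RingOfIntegers F) W] [IsScalarTower (RingOfIntegers F) F W]
    (hW : Module.finrank F W = 3)
    (ψ : LinearMap.BilinForm F W) (hsymm : ψ.IsSymm)
    (hnd : LinearMap.BilinForm.Nondegenerate ψ)
    (N M M' : Submodule (RingOfIntegers F) W)
    (hN : IsIntegralLat (RingOfIntegers F) F W ψ N)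
    (hM : IsMaximalLat (RingOfIntegers F) F W ψ M)
    (hM' : IsMaximalLat (RingOfIntegers F) F W ψ M') :
    APlusIdx (RingOfIntegers F) F W ψ M N = APlusIdx (RingOfIntegers F) F W ψ M' N ∧
    APlusIdx (RingOfIntegers F) F W ψ M N =
      latIdx (RingOfIntegers F) F W M N * latIdx (RingOfIntegers F) F W M N := by
  have hR := RingOfIntegers.not_isField F
  have : FiniteDimensional F W := Module.finite_of_finrank_pos (by omega)
  have h := APlusIdx_eq_latIdx_mul_latIdx hR two_ne_zero hsymm hnd hW hM.1 hN
  refine ⟨?_, h⟩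
  rw [h, APlusIdx_eq_latIdx_mul_latIdx hR two_ne_zero hsymm hnd hW hM'.1 hN,
    hM.latIdx_eq_of_isDedekindDomain hR two_ne_zero hsymm hnd hM' hN.1]
end
end

section
/- Let N be an integral g-lattice in a nondegenerate ternary quadratic space (W,ψ) over an algebraic number field F (or over a nonarchimedean local field). Then [A⁺(N)~/A⁺(N)] = (2⁻¹[Ñ/N])², where Ñ is the dual lattice of N with respect to ψ and A⁺(N)~ is the dual lattice of A⁺(N) with respect to the norm form ν of the quaternion algebra A⁺(W). -/
noncomputable section

namespace Paper

open Module

section PseudoBasis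

variable {R F : Type*} [CommRing R] [Field F] [Algebra R F]

/-- If `I * J = 1` and `I * t ⊆ K`, then `t ∈ J * K`. -/
lemma mem_mul_of_forall_mul_mem {I J K : Submodule R F} (h : I * J = 1) {t : F}
    (ht : ∀ a ∈ I, a * t ∈ K) : t ∈ J * K := by
  have h1 : I * Submodule.span R {t} ≤ K := by
    rw [Submodule.mul_le]
    intro a ha s hs
    obtain ⟨r, rfl⟩ := Submodule.mem_span_singleton.1 hs
    rw [mul_smul_comm]
    exact K.smul_mem r (ht a ha)
  have h2 : J * (I * Submodule.span R {t}) ≤ J * K := by gcongr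
  rw [← mul_assoc, mul_comm J I, h, one_mul] at h2
  exact h2 (Submodule.mem_span_singleton_self t)

lemma prod_mem_prod {ι : Type*} (s : Finset ι) {I : ι → Submodule R F} {x : ι → F}
    (h : ∀ i, x i ∈ I i) : ∏ i ∈ s, x i ∈ ∏ i ∈ s, I i := by
  classical
  induction s using Finset.induction_on with
  | empty => simp [Submodule.mem_one]; exact ⟨1, map_one _⟩
  | insert a s ha ih =>
    rw [Finset.prod_insert ha, Finset.prod_insert ha]
    exact Submodule.mul_mem_mul (h a) ih

variable {V : Type*} [AddCommGroup V] [Module F V] [Module R V]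

/-- `L` is the direct sum of the `I i • b i`. -/
def IsPseudoBasis {n : ℕ} (b : Basis (Fin n) F V) (I : Fin n → Submodule R F)
    (L : Submodule R V) : Prop :=
  ∀ x, x ∈ L ↔ ∀ i, b.repr x i ∈ I i

lemma IsPseudoBasis.smul_mem {n : ℕ} {b : Basis (Fin n) F V} {I : Fin n → Submodule R F}
    {L : Submodule R V} (hL : IsPseudoBasis b I L) {i : Fin n} {a : F} (ha : a ∈ I i) :
    a • b i ∈ L := by
  rw [hL]
  intro j
  rw [map_smul, Basis.repr_self, Finsupp.smul_single, smul_eq_mul, mul_one, Finsupp.single_apply]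
  split_ifs with h
  · exact h ▸ ha
  · exact Submodule.zero_mem _

lemma IsPseudoBasis.dual {n : ℕ} {b : Basis (Fin n) F V} {I J : Fin n → Submodule R F}
    (hIJ : ∀ i, I i * J i = 1) {L : Submodule R V} (hL : IsPseudoBasis b I L)
    (T : LinearMap.BilinForm F V) (hT : T.Nondegenerate) {L' : Submodule R V}
    (hL' : ∀ x, x ∈ L' ↔ ∀ y ∈ L, T x y ∈ (1 : Submodule R F)) :
    IsPseudoBasis (T.dualBasis hT b) J L' := by
  intro x
  rw [hL']
  simp only [LinearMap.BilinForm.dualBasis_repr_apply]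
  constructor
  · intro h i
    rw [← mul_one (J i)]
    refine mem_mul_of_forall_mul_mem (hIJ i) fun a ha => ?_
    simpa using h _ (hL.smul_mem ha)
  · intro h y hy
    rw [← b.sum_repr y, map_sum]
    refine Submodule.sum_mem _ fun i _ => ?_
    rw [map_smul, smul_eq_mul, ← hIJ i]
    exact Submodule.mul_mem_mul ((hL y).1 hy i) (h i)

open scoped Pointwise in
/-- The index of two lattices given by pseudo-bases. -/
lemma latIdx_eq_of_isPseudoBasis {n : ℕ} {b c : Basis (Fin n) F V} {I J K : Fin n → Submodule R F}
    (hIK : ∀ i, I i * K i = 1) {L M : Submodule R V} (hL : IsPseudoBasis b I L)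
    (hM : IsPseudoBasis c J M) :
    latIdx R F V L M = (∏ i, (K i * J i)) * Submodule.span R {(b.toMatrix c).det} := by
  classical
  apply le_antisymm
  · refine Submodule.span_le.2 ?_
    rintro _ ⟨α, hα, rfl⟩
    rw [← LinearMap.det_toMatrix c, ← linearMap_toMatrix_mul_basis_toMatrix c b c, Matrix.det_mul]
    refine Submodule.mul_mem_mul ?_ (Submodule.mem_span_singleton_self _)
    rw [Matrix.det_apply]
    refine Submodule.sum_mem _ fun σ _ => ?_
    rw [Units.smul_def]
    refine zsmul_mem ?_ _
    have key : ∀ i j, LinearMap.toMatrix b c (α : V →ₗ[F] V) i j ∈ K j * J i := by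
      intro i j
      refine mem_mul_of_forall_mul_mem (hIK j) fun a ha => ?_
      have := (hM _).1 (hα _ (hL.smul_mem ha)) i
      simpa [LinearMap.toMatrix_apply] using this
    have h := prod_mem_prod (Finset.univ : Finset (Fin n)) (fun i => key (σ i) i)
    rwa [Finset.prod_mul_distrib, Equiv.prod_comp σ J, ← Finset.prod_mul_distrib] at h
  · have h1 : ∏ i, (K i * J i) = Submodule.span R (∏ i, ((K i * J i : Submodule R F) : Set F)) := by
      rw [← Submodule.prod_span]
      simp only [Submodule.span_eq]
    rw [h1, Submodule.span_mul_span]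
    refine Submodule.span_le.2 ?_
    rintro _ ⟨_, hu, _, rfl, rfl⟩
    obtain ⟨g, hg, rfl⟩ := (Set.mem_fintype_prod _ _).1 hu
    by_cases h0 : ∀ i, g i ≠ 0
    · let α : V ≃ₗ[F] V := b.equiv (c.unitsSMul fun i => Units.mk0 (g i) (h0 i)) (Equiv.refl _)
      have hα : ∀ i, α (b i) = g i • c i := by
        intro i
        simp [α, Basis.unitsSMul_apply]
      have hαc : ∀ x i, c.repr (α x) i = g i * b.repr x i := by
        intro x i
        have h2 : c.coord i ∘ₗ (α : V →ₗ[F] V) = g i • b.coord i := by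
          refine b.ext fun j => ?_
          by_cases hij : j = i <;> simp [hα, hij]
        exact LinearMap.congr_fun h2 x
      refine Submodule.subset_span ⟨α, ?_, ?_⟩
      · intro x hx
        rw [hM]
        intro i
        rw [hαc]
        have h2 := Submodule.mul_mem_mul (hg i) ((hL x).1 hx i)
        rwa [mul_right_comm, mul_comm (K i), hIK, one_mul] at h2
      · rw [← LinearMap.det_toMatrix c, ← linearMap_toMatrix_mul_basis_toMatrix c b c,
          Matrix.det_mul]
        have h3 : LinearMap.toMatrix b c (α : V →ₗ[F] V) = Matrix.diagonal g := by
          ext i j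
          rw [LinearMap.toMatrix_apply, LinearEquiv.coe_coe, hαc, Basis.repr_self,
            Matrix.diagonal_apply, Finsupp.single_apply]
          simp [eq_comm]
        rw [h3, Matrix.det_diagonal]
    · push Not at h0
      obtain ⟨i, hi⟩ := h0
      have h2 : ∏ i, g i = 0 := Finset.prod_eq_zero (Finset.mem_univ i) hi
      simp [h2]

/-- The index of a lattice in its dual with respect to a bilinear form. -/
lemma latIdx_dual {n : ℕ} {b : Basis (Fin n) F V} {I J : Fin n → Submodule R F}
    (hIJ : ∀ i, I i * J i = 1) {L : Submodule R V} (hL : IsPseudoBasis b I L)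
    (T : LinearMap.BilinForm F V) (hT : T.Nondegenerate) {L' : Submodule R V}
    (hL' : ∀ x, x ∈ L' ↔ ∀ y ∈ L, T x y ∈ (1 : Submodule R F)) :
    latIdx R F V L' L =
      (∏ i, I i) ^ 2 * Submodule.span R {(LinearMap.BilinForm.toMatrix b T).det} := by
  rw [latIdx_eq_of_isPseudoBasis (fun i => (mul_comm _ _).trans (hIJ i)) (hL.dual hIJ T hT hL') hL]
  have : (T.dualBasis hT b).toMatrix b = (LinearMap.BilinForm.toMatrix b T).transpose := by
    ext i j
    rw [Basis.toMatrix_apply, LinearMap.BilinForm.dualBasis_repr_apply, Matrix.transpose_apply,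
      LinearMap.BilinForm.toMatrix_apply]
  rw [this, Matrix.det_transpose, Finset.prod_mul_distrib, sq]

end PseudoBasis

section Existence

variable {R F : Type*} [CommRing R] [IsDedekindDomain R] [Field F] [Algebra R F]
  [IsFractionRing R F]

lemma exists_mul_eq_one_of_fg {I : Submodule R F} (hI : I.FG) (h0 : I ≠ ⊥) :
    ∃ J : Submodule R F, I * J = 1 := by
  let I' : FractionalIdeal (nonZeroDivisors R) F :=
    ⟨I, FractionalIdeal.isFractional_of_fg hI⟩
  have h : I' ≠ 0 := by
    intro h
    apply h0
    have := congrArg (fun K : FractionalIdeal (nonZeroDivisors R) F => (K : Submodule R F)) h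
    simpa [I'] using this
  refine ⟨(I'⁻¹ : FractionalIdeal (nonZeroDivisors R) F), ?_⟩
  have := congrArg (fun K : FractionalIdeal (nonZeroDivisors R) F => (K : Submodule R F))
    (mul_inv_cancel₀ h)
  rwa [FractionalIdeal.coe_mul, FractionalIdeal.coe_one] at this

theorem exists_isPseudoBasis (n : ℕ) {V : Type*} [AddCommGroup V] [Module F V] [Module R V]
    [IsScalarTower R F V] (hV : finrank F V = n) [FiniteDimensional F V] {L : Submodule R V}
    (hL : IsLat R F V L) :
    ∃ (b : Basis (Fin n) F V) (I J : Fin n → Submodule R F),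
      (∀ i, I i * J i = 1) ∧ IsPseudoBasis b I L := by
  induction n generalizing V with
  | zero =>
    have : Subsingleton V := finrank_zero_iff.1 hV
    refine ⟨Module.finBasisOfFinrankEq F V hV, fun _ => 1, fun _ => 1, fun i => i.elim0,
      fun x => ?_⟩
    rw [Subsingleton.elim x 0]
    simp
  | succ n ih =>
    obtain ⟨φ, hφ⟩ : ∃ φ : V →ₗ[F] F, φ ≠ 0 := by
      have : Nontrivial V := Module.nontrivial_of_finrank_eq_succ hV
      obtain ⟨v, hv⟩ := exists_ne (0 : V)
      by_contra! h
      exact hv ((Module.forall_dual_apply_eq_zero_iff F v).1 fun φ => by simp [h φ])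
    let φR : V →ₗ[R] F := φ.restrictScalars R
    have hI : (L.map φR).FG := hL.1.map _
    obtain ⟨J₀, hJ₀⟩ := exists_mul_eq_one_of_fg hI (by
      intro h
      apply hφ
      rw [← LinearMap.ker_eq_top, eq_top_iff, ← hL.2, Submodule.span_le]
      intro x hx
      have : φ x ∈ L.map φR := ⟨x, hx, rfl⟩
      rw [h] at this
      simpa using this)
    obtain ⟨e, he, heL⟩ : ∃ e : V, φ e = 1 ∧ ∀ a ∈ L.map φR, a • e ∈ L := by
      have h1 : (1 : F) ∈ L.map φR * J₀ := by
        rw [hJ₀]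
        exact Submodule.one_le.1 le_rfl
      have key : ∀ t ∈ L.map φR * J₀, ∃ e : V, φ e = t ∧ ∀ a ∈ L.map φR, a • e ∈ L := by
        intro t ht
        induction ht using Submodule.mul_induction_on' with
        | mem_mul_mem m hm k hk =>
          obtain ⟨v, hv, rfl⟩ := hm
          refine ⟨k • v, by simp [φR, mul_comm], fun a ha => ?_⟩
          have h2 : a * k ∈ (1 : Submodule R F) := hJ₀ ▸ Submodule.mul_mem_mul ha hk
          obtain ⟨r, hr⟩ := Submodule.mem_one.1 h2
          rw [smul_smul, ← hr, algebraMap_smul]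
          exact L.smul_mem r hv
        | add x _ y _ hx hy =>
          obtain ⟨e, he, h⟩ := hx
          obtain ⟨e', he', h'⟩ := hy
          refine ⟨e + e', by simp [he, he'], fun a ha => ?_⟩
          rw [smul_add]
          exact L.add_mem (h a ha) (h' a ha)
      exact key 1 h1
    let U : Submodule F V := LinearMap.ker φ
    let π : V →ₗ[F] V := LinearMap.id - φ.smulRight e
    have hπ : ∀ x, π x = x - φ x • e := fun x => rfl
    have hπU : ∀ x, π x ∈ U := fun x => by simp [hπ, U, he]
    let πU : V →ₗ[F] U := π.codRestrict U hπU
    have hπL : ∀ x ∈ L, π x ∈ L := fun x hx => L.sub_mem hx (heL _ ⟨x, hx, rfl⟩)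
    let L₁ : Submodule R U := L.comap (U.subtype.restrictScalars R)
    have hL₁ : L₁ = L.map (πU.restrictScalars R) := by
      ext x
      constructor
      · intro hx
        refine ⟨x, hx, Subtype.ext ?_⟩
        have : φ (x : V) = 0 := x.2
        change π x = x
        simp [hπ, this]
      · rintro ⟨y, hy, rfl⟩
        exact hπL y hy
    have hL₁lat : IsLat R F U L₁ := by
      constructor
      · rw [hL₁]
        exact hL.1.map _
      · have h1 : (L₁ : Set U) = πU '' (L : Set V) := by
          rw [hL₁]; rfl
        rw [h1, ← Submodule.map_span, hL.2, Submodule.map_top, LinearMap.range_eq_top]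
        intro x
        refine ⟨x, Subtype.ext ?_⟩
        have : φ (x : V) = 0 := x.2
        change π x = x
        simp [hπ, this]
    have hU : finrank F U = n := by
      have h1 := LinearMap.finrank_range_add_finrank_ker φ
      rw [LinearMap.range_eq_top.2 (LinearMap.surjective hφ), finrank_top, finrank_self, hV] at h1
      change finrank F (LinearMap.ker φ) = n
      omega
    obtain ⟨b, I, J, hIJ, hb⟩ := ih hU hL₁lat
    let b' : Basis (Fin (n + 1)) F V := Basis.mkFinCons e b
      (by
        intro c x hx h
        have h1 := congrArg φ h
        have h2 : φ x = 0 := hx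
        simpa [he, h2] using h1)
      (fun z => ⟨-φ z, by simp [U, he]⟩)
    have hb' : ∀ x, x = φ x • e + ∑ i, b.repr (πU x) i • (b i : V) := by
      intro x
      have h1 := congrArg (Subtype.val) (b.sum_repr (πU x))
      rw [AddSubmonoidClass.coe_finsetSum] at h1
      simp only [Submodule.coe_smul] at h1
      rw [h1]
      change x = φ x • e + (x - φ x • e)
      abel
    have hrepr : ∀ x, (b'.repr x : Fin (n + 1) → F) = Fin.cons (φ x) (b.repr (πU x)) := by
      intro x
      have h1 : x = ∑ i, (Fin.cons (φ x) (b.repr (πU x)) : Fin (n + 1) → F) i • b' i := by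
        rw [Fin.sum_univ_succ]
        simpa [b'] using hb' x
      conv_lhs => rw [h1]
      exact Basis.repr_sum_self b' _
    refine ⟨b', Fin.cons (L.map φR) I, Fin.cons J₀ J, ?_, ?_⟩
    · intro i
      refine Fin.cases ?_ (fun i => ?_) i
      · simpa using hJ₀
      · simpa using hIJ i
    · intro x
      rw [hrepr, Fin.forall_fin_succ]
      simp only [Fin.cons_zero, Fin.cons_succ]
      rw [← hb (πU x)]
      constructor
      · intro hx
        exact ⟨⟨x, hx, rfl⟩, hπL x hx⟩
      · rintro ⟨h1, h2⟩
        have h3 : π x ∈ L := h2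
        have h4 := L.add_mem h3 (heL _ h1)
        rwa [hπ, sub_add_cancel] at h4

end Existence

end Paper

namespace Paper

section Triple

variable {R F : Type*} [CommRing R] [Field F] [Algebra R F]
variable {A : Type*} [Ring A] [Algebra F A]

/-- The relations between the images of three vectors in a Clifford algebra, where `q i` is the
value of the form at the `i`-th vector, and `cij` is the polar form at the `i`-th and `j`-th
vectors. -/
structure IsCliffordTriple (e₀ e₁ e₂ : A) (q₀ q₁ q₂ c₀₁ c₀₂ c₁₂ : F) : Prop where
  sq₀ : e₀ * e₀ = q₀ • (1 : A)
  sq₁ : e₁ * e₁ = q₁ • (1 : A)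
  sq₂ : e₂ * e₂ = q₂ • (1 : A)
  swap₀₁ : e₁ * e₀ = c₀₁ • (1 : A) - e₀ * e₁
  swap₀₂ : e₂ * e₀ = c₀₂ • (1 : A) - e₀ * e₂
  swap₁₂ : e₂ * e₁ = c₁₂ • (1 : A) - e₁ * e₂

namespace IsCliffordTriple

variable {e₀ e₁ e₂ : A} {q₀ q₁ q₂ c₀₁ c₀₂ c₁₂ : F}
  (h : IsCliffordTriple e₀ e₁ e₂ q₀ q₁ q₂ c₀₁ c₀₂ c₁₂)

include h

lemma sq₀_mul (x : A) : e₀ * (e₀ * x) = q₀ • x := by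
  rw [← mul_assoc, h.sq₀, smul_mul_assoc, one_mul]

lemma sq₁_mul (x : A) : e₁ * (e₁ * x) = q₁ • x := by
  rw [← mul_assoc, h.sq₁, smul_mul_assoc, one_mul]

lemma sq₂_mul (x : A) : e₂ * (e₂ * x) = q₂ • x := by
  rw [← mul_assoc, h.sq₂, smul_mul_assoc, one_mul]

lemma swap₀₁_mul (x : A) : e₁ * (e₀ * x) = c₀₁ • x - e₀ * (e₁ * x) := by
  rw [← mul_assoc, h.swap₀₁, sub_mul, smul_mul_assoc, one_mul, mul_assoc]

lemma swap₀₂_mul (x : A) : e₂ * (e₀ * x) = c₀₂ • x - e₀ * (e₂ * x) := by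
  rw [← mul_assoc, h.swap₀₂, sub_mul, smul_mul_assoc, one_mul, mul_assoc]

lemma swap₁₂_mul (x : A) : e₂ * (e₁ * x) = c₁₂ • x - e₁ * (e₂ * x) := by
  rw [← mul_assoc, h.swap₁₂, sub_mul, smul_mul_assoc, one_mul, mul_assoc]

/-- The Gram matrix of the trace form in the basis `1, e₀ e₁, e₀ e₂, e₁ e₂`. -/
lemma gram (i j : Fin 4) :
    (![1, e₀ * e₁, e₀ * e₂, e₁ * e₂] : Fin 4 → A) i *
        (![1, e₁ * e₀, e₂ * e₀, e₂ * e₁] : Fin 4 → A) j +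
      (![1, e₀ * e₁, e₀ * e₂, e₁ * e₂] : Fin 4 → A) j *
        (![1, e₁ * e₀, e₂ * e₀, e₂ * e₁] : Fin 4 → A) i =
      (!![2, c₀₁, c₀₂, c₁₂;
        c₀₁, 2 * q₀ * q₁, q₀ * c₁₂, c₀₁ * c₁₂ - q₁ * c₀₂;
        c₀₂, q₀ * c₁₂, 2 * q₀ * q₂, q₂ * c₀₁;
        c₁₂, c₀₁ * c₁₂ - q₁ * c₀₂, q₂ * c₀₁, 2 * q₁ * q₂] i j) • (1 : A) := by
  fin_cases i <;> fin_cases j <;>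
    simp only [Fin.zero_eta, Fin.mk_one, Fin.reduceFinMk, Matrix.of_apply, Matrix.cons_val,
      mul_one, one_mul, mul_assoc, mul_sub, mul_smul_comm, h.sq₀, h.sq₁,
      h.sq₂, h.swap₀₁, h.swap₀₂, h.swap₁₂, h.sq₀_mul, h.sq₁_mul, h.swap₀₁_mul,
      h.swap₀₂_mul, h.swap₁₂_mul] <;>
    module

end IsCliffordTriple

/-- `x` lies in the span of the ordered monomials in `e₀, e₁, e₂` with coefficients in the
corresponding products of `I₀, I₁, I₂`. -/
def InMonomialSpan (e₀ e₁ e₂ : A) (I₀ I₁ I₂ : Submodule R F) (x : A) : Prop :=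
  ∃ r ∈ (1 : Submodule R F), ∃ u₀₁ ∈ I₀ * I₁, ∃ u₀₂ ∈ I₀ * I₂, ∃ u₁₂ ∈ I₁ * I₂,
  ∃ a₀ ∈ I₀, ∃ a₁ ∈ I₁, ∃ a₂ ∈ I₂, ∃ t ∈ I₀ * I₁ * I₂,
    x = (r • (1 : A) + u₀₁ • (e₀ * e₁) + u₀₂ • (e₀ * e₂) + u₁₂ • (e₁ * e₂)) +
      (a₀ • e₀ + a₁ • e₁ + a₂ • e₂ + t • (e₀ * (e₁ * e₂)))

namespace InMonomialSpan

variable {e₀ e₁ e₂ : A} {I₀ I₁ I₂ : Submodule R F}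

lemma one : InMonomialSpan e₀ e₁ e₂ I₀ I₁ I₂ 1 :=
  ⟨1, Submodule.one_le.1 le_rfl, 0, zero_mem _, 0, zero_mem _, 0, zero_mem _, 0, zero_mem _,
    0, zero_mem _, 0, zero_mem _, 0, zero_mem _, by simp⟩

lemma add {x y : A} (hx : InMonomialSpan e₀ e₁ e₂ I₀ I₁ I₂ x)
    (hy : InMonomialSpan e₀ e₁ e₂ I₀ I₁ I₂ y) : InMonomialSpan e₀ e₁ e₂ I₀ I₁ I₂ (x + y) := by
  obtain ⟨r, hr, u, hu, v, hv, w, hw, a, ha, b, hb, c, hc, t, ht, rfl⟩ := hx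
  obtain ⟨r', hr', u', hu', v', hv', w', hw', a', ha', b', hb', c', hc', t', ht', rfl⟩ := hy
  exact ⟨_, add_mem hr hr', _, add_mem hu hu', _, add_mem hv hv', _, add_mem hw hw',
    _, add_mem ha ha', _, add_mem hb hb', _, add_mem hc hc', _, add_mem ht ht', by module⟩

lemma algebraMap_smul (s : R) {x : A} (hx : InMonomialSpan e₀ e₁ e₂ I₀ I₁ I₂ x) :
    InMonomialSpan e₀ e₁ e₂ I₀ I₁ I₂ (algebraMap R F s • x) := by
  obtain ⟨r, hr, u, hu, v, hv, w, hw, a, ha, b, hb, c, hc, t, ht, rfl⟩ := hx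
  refine ⟨_, Submodule.smul_mem _ s hr, _, Submodule.smul_mem _ s hu, _, Submodule.smul_mem _ s hv,
    _, Submodule.smul_mem _ s hw, _, Submodule.smul_mem _ s ha, _, Submodule.smul_mem _ s hb,
    _, Submodule.smul_mem _ s hc, _, Submodule.smul_mem _ s ht, ?_⟩
  simp only [Algebra.smul_def s]
  module

variable {q₀ q₁ q₂ c₀₁ c₀₂ c₁₂ : F}

lemma mul_mul_mem {X Y Z P : Submodule R F} {a b c : F} (hP : ∀ p ∈ P, p * c ∈ (1 : Submodule R F))
    (ha : a ∈ X) (hb : b ∈ Y) (hXY : X * Y = Z * P) : a * b * c ∈ Z := by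
  have h : a * b ∈ Z * P := hXY ▸ Submodule.mul_mem_mul ha hb
  generalize a * b = d at h ⊢
  induction h using Submodule.mul_induction_on' with
  | mem_mul_mem z hz p hp =>
    rw [mul_assoc, ← mul_one Z]
    exact Submodule.mul_mem_mul hz (hP p hp)
  | add x _ y _ hx hy =>
    rw [add_mul]
    exact add_mem hx hy

lemma mul_mem {X Y Z : Submodule R F} {a b : F} (ha : a ∈ X) (hb : b ∈ Y) (hXY : X * Y = Z) :
    a * b ∈ Z := hXY ▸ Submodule.mul_mem_mul ha hb

lemma smul_e₀_mul (h : IsCliffordTriple e₀ e₁ e₂ q₀ q₁ q₂ c₀₁ c₀₂ c₁₂)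
    (hq₀ : ∀ p ∈ I₀ * I₀, p * q₀ ∈ (1 : Submodule R F))
    {n : F} (hn : n ∈ I₀) {x : A} (hx : InMonomialSpan e₀ e₁ e₂ I₀ I₁ I₂ x) :
    InMonomialSpan e₀ e₁ e₂ I₀ I₁ I₂ ((n • e₀) * x) := by
  obtain ⟨r, hr, u, hu, v, hv, w, hw, a, ha, b, hb, c, hc, t, ht, rfl⟩ := hx
  refine ⟨n * a * q₀, mul_mul_mem hq₀ hn ha (by ring), n * b, mul_mem hn hb (by ring),
    n * c, mul_mem hn hc (by ring), n * t * q₀, mul_mul_mem hq₀ hn ht (by ring),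
    n * r, mul_mem hn hr (by ring), n * u * q₀, mul_mul_mem hq₀ hn hu (by ring),
    n * v * q₀, mul_mul_mem hq₀ hn hv (by ring), n * w, mul_mem hn hw (by ring), ?_⟩
  simp only [mul_one, mul_assoc, mul_add, mul_smul_comm, smul_mul_assoc, h.sq₀, h.sq₀_mul]
  module

lemma smul_e₁_mul (h : IsCliffordTriple e₀ e₁ e₂ q₀ q₁ q₂ c₀₁ c₀₂ c₁₂)
    (hq₁ : ∀ p ∈ I₁ * I₁, p * q₁ ∈ (1 : Submodule R F))
    (hc₀₁ : ∀ p ∈ I₀ * I₁, p * c₀₁ ∈ (1 : Submodule R F))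
    {n : F} (hn : n ∈ I₁) {x : A} (hx : InMonomialSpan e₀ e₁ e₂ I₀ I₁ I₂ x) :
    InMonomialSpan e₀ e₁ e₂ I₀ I₁ I₂ ((n • e₁) * x) := by
  obtain ⟨r, hr, u, hu, v, hv, w, hw, a, ha, b, hb, c, hc, t, ht, rfl⟩ := hx
  refine ⟨n * a * c₀₁ + n * b * q₁,
    add_mem (mul_mul_mem hc₀₁ hn ha (by ring)) (mul_mul_mem hq₁ hn hb (by ring)),
    -(n * a), neg_mem (mul_mem hn ha (by ring)),
    -(n * t * q₁), neg_mem (mul_mul_mem hq₁ hn ht (by ring)),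
    n * c + n * t * c₀₁,
    add_mem (mul_mem hn hc (by ring)) (mul_mul_mem hc₀₁ hn ht (by ring)),
    -(n * u * q₁), neg_mem (mul_mul_mem hq₁ hn hu (by ring)),
    n * r + n * u * c₀₁,
    add_mem (mul_mem hn hr (by ring)) (mul_mul_mem hc₀₁ hn hu (by ring)),
    n * v * c₀₁ + n * w * q₁,
    add_mem (mul_mul_mem hc₀₁ hn hv (by ring)) (mul_mul_mem hq₁ hn hw (by ring)),
    -(n * v), neg_mem (mul_mem hn hv (by ring)), ?_⟩
  simp only [mul_one, mul_assoc, mul_add, mul_smul_comm, smul_mul_assoc, h.sq₁,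
    h.swap₀₁, h.sq₁_mul, h.swap₀₁_mul]
  module

lemma smul_e₂_mul (h : IsCliffordTriple e₀ e₁ e₂ q₀ q₁ q₂ c₀₁ c₀₂ c₁₂)
    (hq₂ : ∀ p ∈ I₂ * I₂, p * q₂ ∈ (1 : Submodule R F))
    (hc₀₂ : ∀ p ∈ I₀ * I₂, p * c₀₂ ∈ (1 : Submodule R F))
    (hc₁₂ : ∀ p ∈ I₁ * I₂, p * c₁₂ ∈ (1 : Submodule R F))
    {n : F} (hn : n ∈ I₂) {x : A} (hx : InMonomialSpan e₀ e₁ e₂ I₀ I₁ I₂ x) :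
    InMonomialSpan e₀ e₁ e₂ I₀ I₁ I₂ ((n • e₂) * x) := by
  obtain ⟨r, hr, u, hu, v, hv, w, hw, a, ha, b, hb, c, hc, t, ht, rfl⟩ := hx
  refine ⟨n * a * c₀₂ + n * b * c₁₂ + n * c * q₂,
    add_mem (add_mem (mul_mul_mem hc₀₂ hn ha (by ring)) (mul_mul_mem hc₁₂ hn hb (by ring)))
      (mul_mul_mem hq₂ hn hc (by ring)),
    n * t * q₂, mul_mul_mem hq₂ hn ht (by ring),
    -(n * a) - n * t * c₁₂,
    sub_mem (neg_mem (mul_mem hn ha (by ring))) (mul_mul_mem hc₁₂ hn ht (by ring)),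
    -(n * b) + n * t * c₀₂,
    add_mem (neg_mem (mul_mem hn hb (by ring))) (mul_mul_mem hc₀₂ hn ht (by ring)),
    -(n * u * c₁₂) - n * v * q₂,
    sub_mem (neg_mem (mul_mul_mem hc₁₂ hn hu (by ring))) (mul_mul_mem hq₂ hn hv (by ring)),
    n * u * c₀₂ - n * w * q₂,
    sub_mem (mul_mul_mem hc₀₂ hn hu (by ring)) (mul_mul_mem hq₂ hn hw (by ring)),
    n * r + n * v * c₀₂ + n * w * c₁₂,
    add_mem (add_mem (mul_mem hn hr (by ring)) (mul_mul_mem hc₀₂ hn hv (by ring)))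
      (mul_mul_mem hc₁₂ hn hw (by ring)),
    n * u, mul_mem hn hu (by ring), ?_⟩
  simp only [mul_one, mul_assoc, mul_add, mul_sub, mul_smul_comm, smul_mul_assoc, h.sq₂,
    h.swap₀₂, h.swap₁₂, h.swap₀₂_mul, h.swap₁₂_mul]
  module

variable [Algebra R A] [IsScalarTower R F A]

theorem of_mem_adjoin (h : IsCliffordTriple e₀ e₁ e₂ q₀ q₁ q₂ c₀₁ c₀₂ c₁₂)
    (hq₀ : ∀ p ∈ I₀ * I₀, p * q₀ ∈ (1 : Submodule R F))
    (hq₁ : ∀ p ∈ I₁ * I₁, p * q₁ ∈ (1 : Submodule R F))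
    (hq₂ : ∀ p ∈ I₂ * I₂, p * q₂ ∈ (1 : Submodule R F))
    (hc₀₁ : ∀ p ∈ I₀ * I₁, p * c₀₁ ∈ (1 : Submodule R F))
    (hc₀₂ : ∀ p ∈ I₀ * I₂, p * c₀₂ ∈ (1 : Submodule R F))
    (hc₁₂ : ∀ p ∈ I₁ * I₂, p * c₁₂ ∈ (1 : Submodule R F))
    {S : Set A} (hS : ∀ s ∈ S, ∃ a₀ ∈ I₀, ∃ a₁ ∈ I₁, ∃ a₂ ∈ I₂,
      s = a₀ • e₀ + a₁ • e₁ + a₂ • e₂)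
    {x : A} (hx : x ∈ Algebra.adjoin R S) : InMonomialSpan e₀ e₁ e₂ I₀ I₁ I₂ x := by
  suffices H : ∀ y, InMonomialSpan e₀ e₁ e₂ I₀ I₁ I₂ y →
      InMonomialSpan e₀ e₁ e₂ I₀ I₁ I₂ (x * y) by
    simpa using H 1 one
  induction hx using Algebra.adjoin_induction with
  | mem s hs =>
    intro y hy
    obtain ⟨a₀, h₀, a₁, h₁, a₂, h₂, rfl⟩ := hS s hs
    rw [add_mul, add_mul]
    exact ((smul_e₀_mul h hq₀ h₀ hy).add (smul_e₁_mul h hq₁ hc₀₁ h₁ hy)).add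
      (smul_e₂_mul h hq₂ hc₀₂ hc₁₂ h₂ hy)
  | algebraMap r =>
    intro y hy
    rw [IsScalarTower.algebraMap_apply R F A, ← Algebra.smul_def]
    exact hy.algebraMap_smul r
  | add x y _ _ hx hy =>
    intro z hz
    rw [add_mul]
    exact (hx z hz).add (hy z hz)
  | mul x y _ _ hx hy =>
    intro z hz
    rw [mul_assoc]
    exact hx _ (hy z hz)

end InMonomialSpan

end Triple

end Paper

namespace Paper

open Module CliffordAlgebra

section EvenClifford

variable {R F : Type*} [CommRing R] [Field F] [Algebra R F]
variable {W : Type*} [AddCommGroup W] [Module F W]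
variable {ψ : LinearMap.BilinForm F W}

local notation "Cl" ψ:max => CliffordAlgebra (LinearMap.BilinMap.toQuadraticMap ψ)

lemma isCliffordTriple_ι (hsymm : ψ.IsSymm) (b : Fin 3 → W) :
    IsCliffordTriple (ι (LinearMap.BilinMap.toQuadraticMap ψ) (b 0)) (ι _ (b 1)) (ι _ (b 2))
      (ψ (b 0) (b 0)) (ψ (b 1) (b 1)) (ψ (b 2) (b 2))
      (2 * ψ (b 0) (b 1)) (2 * ψ (b 0) (b 2)) (2 * ψ (b 1) (b 2)) := by
  have hsq : ∀ v, ι (LinearMap.BilinMap.toQuadraticMap ψ) v * ι _ v = ψ v v • (1 : Cl ψ) := by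
    intro v
    rw [ι_sq_scalar, Algebra.algebraMap_eq_smul_one, LinearMap.BilinMap.toQuadraticMap_apply]
  have hswap : ∀ v w, ι (LinearMap.BilinMap.toQuadraticMap ψ) w * ι _ v =
      (2 * ψ v w) • (1 : Cl ψ) - ι _ v * ι _ w := by
    intro v w
    rw [eq_sub_iff_add_eq, ι_mul_ι_add_swap, Algebra.algebraMap_eq_smul_one,
      LinearMap.BilinMap.polar_toQuadraticMap, hsymm.eq w v, two_mul]
  exact ⟨hsq _, hsq _, hsq _, hswap _ _, hswap _ _, hswap _ _⟩

/-- The family `1, e₀ e₁, e₀ e₂, e₁ e₂` in the even Clifford algebra. -/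
def evenFamily (ψ : LinearMap.BilinForm F W) (b : Fin 3 → W) :
    Fin 4 → Subalgebra.toSubmodule (even (LinearMap.BilinMap.toQuadraticMap ψ)) :=
  ![⟨1, one_mem (even _)⟩, ⟨_, ι_mul_ι_mem_evenOdd_zero _ (b 0) (b 1)⟩,
    ⟨_, ι_mul_ι_mem_evenOdd_zero _ (b 0) (b 2)⟩, ⟨_, ι_mul_ι_mem_evenOdd_zero _ (b 1) (b 2)⟩]

/-- The Gram matrix of the trace form on `evenFamily`. -/
def evenGram (ψ : LinearMap.BilinForm F W) (b : Fin 3 → W) : Matrix (Fin 4) (Fin 4) F :=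
  !![2, 2 * ψ (b 0) (b 1), 2 * ψ (b 0) (b 2), 2 * ψ (b 1) (b 2);
    2 * ψ (b 0) (b 1), 2 * ψ (b 0) (b 0) * ψ (b 1) (b 1), ψ (b 0) (b 0) * (2 * ψ (b 1) (b 2)),
      (2 * ψ (b 0) (b 1)) * (2 * ψ (b 1) (b 2)) - ψ (b 1) (b 1) * (2 * ψ (b 0) (b 2));
    2 * ψ (b 0) (b 2), ψ (b 0) (b 0) * (2 * ψ (b 1) (b 2)), 2 * ψ (b 0) (b 0) * ψ (b 2) (b 2),
      ψ (b 2) (b 2) * (2 * ψ (b 0) (b 1));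
    2 * ψ (b 1) (b 2), (2 * ψ (b 0) (b 1)) * (2 * ψ (b 1) (b 2)) - ψ (b 1) (b 1) *
      (2 * ψ (b 0) (b 2)), ψ (b 2) (b 2) * (2 * ψ (b 0) (b 1)), 2 * ψ (b 1) (b 1) * ψ (b 2) (b 2)]

lemma det_evenGram (h2 : (2 : F) ≠ 0) (hsymm : ψ.IsSymm) (b : Basis (Fin 3) F W) :
    (evenGram ψ b).det = (2⁻¹ * (LinearMap.BilinForm.toMatrix b ((2 : F) • ψ)).det) ^ 2 := by
  have h : 2⁻¹ * (LinearMap.BilinForm.toMatrix b ((2 : F) • ψ)).det =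
      4 * ψ (b 0) (b 0) * ψ (b 1) (b 1) * ψ (b 2) (b 2) +
        8 * ψ (b 0) (b 1) * ψ (b 0) (b 2) * ψ (b 1) (b 2)
        - 4 * (ψ (b 0) (b 0) * ψ (b 1) (b 2) ^ 2 + ψ (b 1) (b 1) * ψ (b 0) (b 2) ^ 2
          + ψ (b 2) (b 2) * ψ (b 0) (b 1) ^ 2) := by
    rw [inv_mul_eq_iff_eq_mul₀ h2, Matrix.det_fin_three]
    simp only [LinearMap.BilinForm.toMatrix_apply, LinearMap.smul_apply, smul_eq_mul,
      hsymm.eq (b 1) (b 0), hsymm.eq (b 2) (b 0), hsymm.eq (b 2) (b 1)]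
    ring
  rw [h, evenGram]
  simp [Matrix.det_succ_row_zero, Fin.sum_univ_succ, Fin.succAbove]
  ring

lemma evenFamily_gram (hsymm : ψ.IsSymm) (b : Fin 3 → W) (i j : Fin 4) :
    (evenFamily ψ b i : Cl ψ) * reverse (evenFamily ψ b j : Cl ψ) +
      (evenFamily ψ b j : Cl ψ) * reverse (evenFamily ψ b i : Cl ψ) =
    evenGram ψ b i j • (1 : Cl ψ) := by
  have h := (isCliffordTriple_ι hsymm b).gram i j
  have h1 : ∀ i, (evenFamily ψ b i : Cl ψ) =
      (![1, ι _ (b 0) * ι _ (b 1), ι _ (b 0) * ι _ (b 2), ι _ (b 1) * ι _ (b 2)] :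
        Fin 4 → Cl ψ) i := by
    intro i
    fin_cases i <;> rfl
  have h2 : ∀ i, reverse (evenFamily ψ b i : Cl ψ) =
      (![1, ι _ (b 1) * ι _ (b 0), ι _ (b 2) * ι _ (b 0), ι _ (b 2) * ι _ (b 1)] :
        Fin 4 → Cl ψ) i := by
    intro i
    fin_cases i <;> simp [evenFamily]
  rw [h2, h2, h1, h1]
  exact h

lemma trace_sum (hsymm : ψ.IsSymm) (b : Fin 3 → W) (x y : Fin 4 → F) :
    ((∑ i, x i • evenFamily ψ b i : _) : Cl ψ) * reverse ((∑ i, y i • evenFamily ψ b i : _) : Cl ψ) +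
      ((∑ i, y i • evenFamily ψ b i : _) : Cl ψ) *
        reverse ((∑ i, x i • evenFamily ψ b i : _) : Cl ψ) =
    (∑ i, ∑ j, x i * evenGram ψ b i j * y j) • (1 : Cl ψ) := by
  simp only [AddSubmonoidClass.coe_finsetSum, Submodule.coe_smul, map_sum, map_smul,
    Finset.sum_mul_sum, smul_mul_smul_comm, Finset.sum_smul]
  rw [Finset.sum_comm (s := Finset.univ) (t := Finset.univ)
    (f := fun i j => (y i * x j) • ((evenFamily ψ b i : Cl ψ) * reverse (evenFamily ψ b j : Cl ψ))),
    ← Finset.sum_add_distrib]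
  refine Finset.sum_congr rfl fun i _ => ?_
  rw [← Finset.sum_add_distrib]
  refine Finset.sum_congr rfl fun j _ => ?_
  rw [mul_comm (y j), ← smul_add, evenFamily_gram hsymm, smul_smul]
  congr 1
  ring

lemma eq_sum_evenFamily {b : Fin 3 → W} {I₀ I₁ I₂ : Submodule R F} {x : Cl ψ}
    (hx : InMonomialSpan (ι _ (b 0)) (ι _ (b 1)) (ι _ (b 2)) I₀ I₁ I₂ x)
    (hxe : x ∈ evenOdd (LinearMap.BilinMap.toQuadraticMap ψ) 0) :
    ∃ a : Fin 4 → F, (∀ i, a i ∈ (![1, I₀ * I₁, I₀ * I₂, I₁ * I₂] : Fin 4 → Submodule R F) i) ∧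
      x = (∑ i, a i • evenFamily ψ b i : _) := by
  obtain ⟨r, hr, u, hu, v, hv, w, hw, a₀, -, a₁, -, a₂, -, t, -, rfl⟩ := hx
  refine ⟨![r, u, v, w], fun i => ?_, ?_⟩
  · fin_cases i <;> assumption
  · have hE : r • (1 : Cl ψ) + u • (ι _ (b 0) * ι _ (b 1)) + v • (ι _ (b 0) * ι _ (b 2)) +
        w • (ι _ (b 1) * ι _ (b 2)) = ((∑ i, (![r, u, v, w] : Fin 4 → F) i • evenFamily ψ b i :
          Subalgebra.toSubmodule (even (LinearMap.BilinMap.toQuadraticMap ψ))) : Cl ψ) := by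
      rw [Fin.sum_univ_four]
      rfl
    rw [hE] at hxe ⊢
    have hO := (Submodule.add_mem_iff_right _ (Subtype.property _)).1 hxe
    have h3 : ι _ (b 0) * (ι _ (b 1) * ι _ (b 2)) ∈
        evenOdd (LinearMap.BilinMap.toQuadraticMap ψ) 1 :=
      evenOdd_mul_le _ 1 0
        (Submodule.mul_mem_mul (ι_mem_evenOdd_one _ _) (ι_mul_ι_mem_evenOdd_zero _ _ _))
    have hO' := add_mem (add_mem (add_mem
      (Submodule.smul_mem _ a₀ (ι_mem_evenOdd_one (LinearMap.BilinMap.toQuadraticMap ψ) (b 0)))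
      (Submodule.smul_mem _ a₁ (ι_mem_evenOdd_one _ (b 1))))
      (Submodule.smul_mem _ a₂ (ι_mem_evenOdd_one _ (b 2)))) (Submodule.smul_mem _ t h3)
    rw [Submodule.disjoint_def.1 (evenOdd_isCompl _).disjoint _ hO hO', add_zero]

lemma exists_basis_even (h2 : (2 : F) ≠ 0) (hsymm : ψ.IsSymm) (b : Basis (Fin 3) F W)
    (hdet : (evenGram ψ b).det ≠ 0) :
    ∃ B : Basis (Fin 4) F (Subalgebra.toSubmodule (even (LinearMap.BilinMap.toQuadraticMap ψ))),
      ⇑B = evenFamily ψ b := by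
  have : Invertible (2 : F) := invertibleOfNonzero h2
  have hli : LinearIndependent F (evenFamily ψ b) := by
    rw [Fintype.linearIndependent_iff]
    intro g hg
    have h : Matrix.vecMul g (evenGram ψ b) = 0 := by
      ext j
      have h1 := trace_sum hsymm b g (Pi.single j 1)
      rw [hg] at h1
      simp only [ZeroMemClass.coe_zero, zero_mul, map_zero, mul_zero, add_zero] at h1
      have h3 := (smul_eq_zero.1 h1.symm).resolve_right one_ne_zero
      simpa [Pi.single_apply, Matrix.vecMul, dotProduct] using h3
    exact congrFun (Matrix.eq_zero_of_vecMul_eq_zero hdet h)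
  refine ⟨Basis.mk hli ?_, Basis.coe_mk _ _⟩
  intro x _
  have h1 : ∀ y : F, y ∈ (1 : Submodule F F) := fun y => Submodule.mem_one.2 ⟨y, rfl⟩
  have hx : (x : Cl ψ) ∈ Algebra.adjoin F
      (Set.range (ι (LinearMap.BilinMap.toQuadraticMap ψ))) := by
    rw [adjoin_range_ι]
    trivial
  have hx' : InMonomialSpan (ι _ (b 0)) (ι _ (b 1)) (ι _ (b 2)) (1 : Submodule F F) 1 1
      (x : Cl ψ) := by
    refine InMonomialSpan.of_mem_adjoin (isCliffordTriple_ι hsymm b) (fun _ _ => h1 _)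
      (fun _ _ => h1 _) (fun _ _ => h1 _) (fun _ _ => h1 _) (fun _ _ => h1 _) (fun _ _ => h1 _)
      ?_ hx
    rintro _ ⟨w, rfl⟩
    refine ⟨b.repr w 0, h1 _, b.repr w 1, h1 _, b.repr w 2, h1 _, ?_⟩
    conv_lhs => rw [← b.sum_repr w]
    simp [Fin.sum_univ_three, -Basis.sum_repr]
  obtain ⟨a, -, ha⟩ := eq_sum_evenFamily hx' x.2
  rw [Subtype.ext ha]
  exact Submodule.sum_mem _ fun i _ =>
    Submodule.smul_mem _ _ (Submodule.subset_span (Set.mem_range_self i))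

variable [Module R W] [IsScalarTower R F W]

/-- `A⁺(N)` is the direct sum of `1`, `I 0 I 1 e₀ e₁`, `I 0 I 2 e₀ e₂` and `I 1 I 2 e₁ e₂`. -/
lemma isPseudoBasis_APlus (hsymm : ψ.IsSymm) {b : Basis (Fin 3) F W}
    {I : Fin 3 → Submodule R F} {N : Submodule R W} (hN : IsPseudoBasis b I N)
    (hq : ∀ i, ∀ p ∈ I i * I i, p * ψ (b i) (b i) ∈ (1 : Submodule R F))
    (hc : ∀ i j, ∀ p ∈ I i * I j, p * (2 * ψ (b i) (b j)) ∈ (1 : Submodule R F))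
    {B : Basis (Fin 4) F (Subalgebra.toSubmodule (even (LinearMap.BilinMap.toQuadraticMap ψ)))}
    (hB : ⇑B = evenFamily ψ b) :
    IsPseudoBasis B (![1, I 0 * I 1, I 0 * I 2, I 1 * I 2])
      (Submodule.comap ((Submodule.subtype _).restrictScalars R)
        (APlusSub R F W (LinearMap.BilinMap.toQuadraticMap ψ) N)) := by
  intro x
  constructor
  · rintro ⟨hxe, hxN⟩
    have hx : InMonomialSpan (ι _ (b 0)) (ι _ (b 1)) (ι _ (b 2)) (I 0) (I 1) (I 2) (x : Cl ψ) := by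
      refine InMonomialSpan.of_mem_adjoin (isCliffordTriple_ι hsymm b) (hq 0) (hq 1) (hq 2)
        (hc 0 1) (hc 0 2) (hc 1 2) ?_ hxN
      rintro _ ⟨w, hw, rfl⟩
      have h := (hN w).1 hw
      refine ⟨b.repr w 0, h 0, b.repr w 1, h 1, b.repr w 2, h 2, ?_⟩
      conv_lhs => rw [← b.sum_repr w]
      simp [Fin.sum_univ_three, -Basis.sum_repr]
    obtain ⟨a, ha, hxa⟩ := eq_sum_evenFamily hx x.2
    rw [Subtype.ext hxa, ← hB]
    intro i
    rw [Basis.repr_sum_self]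
    exact ha i
  · intro h
    refine ⟨x.2, ?_⟩
    have hgen : ∀ i, ∀ a ∈ I i, a • ι _ (b i) ∈
        cliffordOrder R F W (LinearMap.BilinMap.toQuadraticMap ψ) N := by
      intro i a ha
      rw [← map_smul]
      exact Algebra.subset_adjoin ⟨_, hN.smul_mem ha, rfl⟩
    have hmul : ∀ i j, ∀ a ∈ I i * I j, a • (ι _ (b i) * ι _ (b j)) ∈
        cliffordOrder R F W (LinearMap.BilinMap.toQuadraticMap ψ) N := by
      intro i j a ha
      induction ha using Submodule.mul_induction_on' with
      | mem_mul_mem m hm n hn =>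
        rw [← smul_mul_smul_comm]
        exact mul_mem (hgen i m hm) (hgen j n hn)
      | add x _ y _ hx hy =>
        rw [add_smul]
        exact add_mem hx hy
    have hone : B.repr x 0 • (1 : Cl ψ) ∈
        cliffordOrder R F W (LinearMap.BilinMap.toQuadraticMap ψ) N := by
      obtain ⟨r, hr⟩ := Submodule.mem_one.1 (h 0)
      rw [← hr, algebraMap_smul]
      exact Subalgebra.smul_mem _ (one_mem _) r
    change (x : Cl ψ) ∈ cliffordOrder R F W (LinearMap.BilinMap.toQuadraticMap ψ) N
    rw [← B.sum_repr x, hB, Fin.sum_univ_four]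
    exact add_mem (add_mem (add_mem hone (hmul 0 1 _ (h 1))) (hmul 0 2 _ (h 2)))
      (hmul 1 2 _ (h 3))

/-- The trace form on the even Clifford algebra is scalar-valued with Gram matrix `evenGram`. -/
lemma traceMap_eq (hsymm : ψ.IsSymm) {b : Fin 3 → W}
    {B : Basis (Fin 4) F (Subalgebra.toSubmodule (even (LinearMap.BilinMap.toQuadraticMap ψ)))}
    (hB : ⇑B = evenFamily ψ b)
    (x y : Subalgebra.toSubmodule (even (LinearMap.BilinMap.toQuadraticMap ψ))) :
    traceMap R F W (LinearMap.BilinMap.toQuadraticMap ψ) y x =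
      algebraMap F (Cl ψ) (Matrix.toBilin B (evenGram ψ b) x y) := by
  have h := trace_sum hsymm b (B.repr x) (B.repr y)
  rw [← hB, B.sum_repr, B.sum_repr] at h
  rw [Matrix.toBilin_apply, Algebra.algebraMap_eq_smul_one, ← h]
  rfl

lemma mem_normDual_iff (h2 : (2 : F) ≠ 0) (hsymm : ψ.IsSymm) {b : Fin 3 → W}
    {B : Basis (Fin 4) F (Subalgebra.toSubmodule (even (LinearMap.BilinMap.toQuadraticMap ψ)))}
    (hB : ⇑B = evenFamily ψ b) {o : Submodule R (Cl ψ)}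
    (ho : o ≤ Subalgebra.toSubmodule (evenR R F W (LinearMap.BilinMap.toQuadraticMap ψ)))
    (x : Subalgebra.toSubmodule (even (LinearMap.BilinMap.toQuadraticMap ψ))) :
    x ∈ Submodule.comap ((Submodule.subtype _).restrictScalars R)
        (normDual R F W (LinearMap.BilinMap.toQuadraticMap ψ) o) ↔
      ∀ y ∈ Submodule.comap ((Submodule.subtype
          (Subalgebra.toSubmodule (even (LinearMap.BilinMap.toQuadraticMap ψ)))).restrictScalars R) o,
        Matrix.toBilin B (evenGram ψ b) x y ∈ (1 : Submodule R F) := by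
  have : Invertible (2 : F) := invertibleOfNonzero h2
  have key : ∀ t : F, algebraMap F (Cl ψ) t ∈ oneLat R F W (LinearMap.BilinMap.toQuadraticMap ψ) ↔
      t ∈ (1 : Submodule R F) := by
    intro t
    rw [oneLat, LinearMap.mem_range, Submodule.mem_one]
    refine exists_congr fun r => ?_
    rw [Algebra.linearMap_apply, IsScalarTower.algebraMap_apply R F (Cl ψ)]
    exact (algebraMap F (Cl ψ)).injective.eq_iff
  have hx : (x : Cl ψ) ∈
      Subalgebra.toSubmodule (evenR R F W (LinearMap.BilinMap.toQuadraticMap ψ)) := x.2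
  simp only [normDual, Submodule.mem_comap, Submodule.mem_inf, Submodule.mem_iInf,
    LinearMap.coe_restrictScalars, Submodule.subtype_apply, hx, true_and]
  constructor
  · intro h y hy
    rw [← key, ← traceMap_eq (R := R) hsymm hB]
    exact h y hy
  · intro h y hy
    have := h ⟨y, ho hy⟩ hy
    rw [← key, ← traceMap_eq (R := R) hsymm hB] at this
    exact this

end EvenClifford

section Integrality

variable {R F : Type*} [CommRing R] [Field F] [Algebra R F]
variable {W : Type*} [AddCommGroup W] [Module F W] [Module R W]
variable {ψ : LinearMap.BilinForm F W}

lemma mul_self_mem_one [IsIntegrallyClosed R] [IsFractionRing R F] {N : Submodule R W}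
    (hN : IsIntegralLat R F W ψ N) {n : ℕ} {b : Basis (Fin n) F W} {I : Fin n → Submodule R F} (hI : IsPseudoBasis b I N) (i : Fin n) :
    ∀ p ∈ I i * I i, p * ψ (b i) (b i) ∈ (1 : Submodule R F) := by
  intro p hp
  induction hp using Submodule.mul_induction_on' with
  | mem_mul_mem m hm n hn =>
    obtain ⟨r, hr⟩ := hN.2 _ (hI.smul_mem hm)
    obtain ⟨s, hs⟩ := hN.2 _ (hI.smul_mem hn)
    simp only [map_smul, LinearMap.smul_apply, smul_eq_mul] at hr hs
    have h : IsIntegral R (m * n * ψ (b i) (b i)) := by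
      refine IsIntegral.of_pow two_pos ?_
      have h1 : (m * n * ψ (b i) (b i)) ^ 2 = algebraMap R F (r * s) := by
        rw [map_mul, hr, hs]
        ring
      rw [h1]
      exact isIntegral_algebraMap
    exact Submodule.mem_one.2 (IsIntegrallyClosed.isIntegral_iff.1 h)
  | add x _ y _ hx hy =>
    rw [add_mul]
    exact add_mem hx hy

lemma mul_polar_mem_one (hsymm : ψ.IsSymm) {N : Submodule R W} (hN : IsIntegralLat R F W ψ N)
    {n : ℕ} {b : Basis (Fin n) F W} {I : Fin n → Submodule R F} (hI : IsPseudoBasis b I N)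
    (i j : Fin n) :
    ∀ p ∈ I i * I j, p * (2 * ψ (b i) (b j)) ∈ (1 : Submodule R F) := by
  intro p hp
  induction hp using Submodule.mul_induction_on' with
  | mem_mul_mem m hm n hn =>
    have hx := hI.smul_mem hm
    have hy := hI.smul_mem hn
    have h : ∀ x ∈ N, ψ x x ∈ (1 : Submodule R F) := fun x hx => Submodule.mem_one.2 (hN.2 x hx)
    have h1 := sub_mem (sub_mem (h _ (add_mem hx hy)) (h _ hx)) (h _ hy)
    convert h1 using 1
    simp only [map_smul, map_add, LinearMap.add_apply, LinearMap.smul_apply, smul_eq_mul,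
      hsymm.eq (b j) (b i)]
    ring
  | add x _ y _ hx hy =>
    rw [add_mul]
    exact add_mem hx hy

end Integrality

/-- The index formula over an arbitrary Dedekind domain whose fraction field does not have
characteristic two. -/
theorem APlusDualIdx_eq {R F : Type*} [CommRing R] [IsDedekindDomain R] [Field F] [Algebra R F]
    [IsFractionRing R F] (h2 : (2 : F) ≠ 0) {W : Type*} [AddCommGroup W] [Module F W] [Module R W]
    [IsScalarTower R F W] (hW : finrank F W = 3) {ψ : LinearMap.BilinForm F W}
    (hsymm : ψ.IsSymm) (hnd : ψ.Nondegenerate) {N : Submodule R W}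
    (hN : IsIntegralLat R F W ψ N) :
    APlusDualIdx R F W ψ N = halfDualIdx R F W ψ N * halfDualIdx R F W ψ N := by
  have : FiniteDimensional F W := Module.finite_of_finrank_eq_succ hW
  obtain ⟨b, I, J, hIJ, hb⟩ := exists_isPseudoBasis 3 hW hN.1
  have hnd' : ((2 : F) • ψ).Nondegenerate := by
    rw [LinearMap.BilinForm.nondegenerate_iff_det_ne_zero b] at hnd ⊢
    rw [map_smul, Matrix.det_smul]
    exact mul_ne_zero (pow_ne_zero _ h2) hnd
  have hdet : (evenGram ψ b).det ≠ 0 := by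
    rw [det_evenGram h2 hsymm]
    exact pow_ne_zero _ (mul_ne_zero (inv_ne_zero h2)
      ((LinearMap.BilinForm.nondegenerate_iff_det_ne_zero b).1 hnd'))
  obtain ⟨B, hB⟩ := exists_basis_even h2 hsymm b hdet
  have hW' : latIdx R F W (dualLat R F W ψ N) N =
      (∏ i, I i) ^ 2 *
        Submodule.span R {(LinearMap.BilinForm.toMatrix b ((2 : F) • ψ)).det} := by
    refine latIdx_dual hIJ hb _ hnd' fun x => ?_
    simp only [dualLat, Submodule.mem_iInf, Submodule.mem_comap, Submodule.one_eq_range]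
    rfl
  have hA : APlusDualIdx R F W ψ N =
      (∏ i, (![1, I 0 * I 1, I 0 * I 2, I 1 * I 2] : Fin 4 → Submodule R F) i) ^ 2 *
        Submodule.span R {(evenGram ψ b).det} := by
    rw [← LinearMap.BilinForm.toMatrix_toBilin B (evenGram ψ b)]
    refine latIdx_dual (J := ![1, J 0 * J 1, J 0 * J 2, J 1 * J 2]) ?_
      (isPseudoBasis_APlus hsymm hb (mul_self_mem_one hN hb) (mul_polar_mem_one hsymm hN hb) hB)
      _ ?_ (mem_normDual_iff h2 hsymm hB fun x hx => hx.1)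
    · have h : ∀ i j, I i * I j * (J i * J j) = 1 := by
        intro i j
        rw [mul_mul_mul_comm, hIJ, hIJ, one_mul]
      intro i
      fin_cases i
      · exact one_mul 1
      · exact h 0 1
      · exact h 0 2
      · exact h 1 2
    · rw [LinearMap.BilinForm.nondegenerate_iff_det_ne_zero B,
        LinearMap.BilinForm.toMatrix_toBilin]
      exact hdet
  have hspan : ∀ s t : F, Submodule.span R {s * t} =
      Submodule.span R {s} * Submodule.span R {t} := by
    intro s t
    rw [Submodule.span_mul_span, Set.singleton_mul_singleton]
  rw [hA, halfDualIdx, hW', det_evenGram h2 hsymm, sq (2⁻¹ * _), hspan, hspan,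
    Fin.prod_univ_four, Fin.prod_univ_three]
  simp only [Matrix.cons_val]
  ring

end Paper

open Paper NumberField

/-- For an integral lattice `N` in a nondegenerate ternary quadratic
space `(W,ψ)` over a number field `F`, one has `[A⁺(N)~/A⁺(N)] = (2⁻¹[Ñ/N])²`, where
`Ñ` is the dual of `N` with respect to `ψ` and `A⁺(N)~` is the dual of `A⁺(N)` with
respect to the norm form of the quaternion algebra `A⁺(W)`. -/
theorem statement1
    (F : Type*) [Field F] [NumberField F]
    (W : Type*) [AddCommGroup W] [Module F W]
    [Module (RingOfIntegers F) W] [IsScalarTower (RingOfIntegers F) F W]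
    (hW : Module.finrank F W = 3)
    (ψ : LinearMap.BilinForm F W) (hsymm : ψ.IsSymm)
    (hnd : LinearMap.BilinForm.Nondegenerate ψ)
    (N : Submodule (RingOfIntegers F) W)
    (hN : IsIntegralLat (RingOfIntegers F) F W ψ N) :
    APlusDualIdx (RingOfIntegers F) F W ψ N =
      halfDualIdx (RingOfIntegers F) F W ψ N * halfDualIdx (RingOfIntegers F) F W ψ N := by
  exact APlusDualIdx_eq two_ne_zero hW hsymm hnd hN
end
end
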